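/- Let (R, 𝔪) be a local Noetherian ring, 𝔞 an ideal, and M a nonzero finitely generated R-module of dimension d with H^d_𝔞(M) ≠ 0. Then Ann_R(H^d_𝔞(M)) = Ann_R(M / T_R(𝔞, M)), where T_R(𝔞, M) is the largest submodule of M whose cohomological dimension with respect to 𝔞 is strictly less than d. -/

import Mathlib

open CategoryTheory

universe u

/-- `H^i_I(M) ≠ 0`: the `i`-th local cohomology of `M` with respect to `I` is nonzero. -/
abbrev LCNonzero {R : Type u} [CommRing R] (I : Ideal R) (i : ℕ)
    (M : Type u) [AddCommGroup M] [Module R M] : Prop :=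
  Nontrivial ((localCohomology I i).obj (ModuleCat.of R M))

/-- Cohomological dimension `cd(I, M) = sup {i : H^i_I(M) ≠ 0}`, as an element of
`WithBot ℕ∞` (it is `⊥` if all local cohomology of `M` vanishes). -/
noncomputable def cohDim {R : Type u} [CommRing R] (I : Ideal R)
    (M : Type u) [AddCommGroup M] [Module R M] : WithBot ℕ∞ :=
  sSup {n : WithBot ℕ∞ | ∃ i : ℕ, n = (i : ℕ∞) ∧ LCNonzero I i M}

/-- Krull dimension of a module, i.e. the Krull dimension of `R ⧸ Ann_R M`. -/
noncomputable def modDim (R : Type u) [CommRing R]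
    (M : Type u) [AddCommGroup M] [Module R M] : WithBot ℕ∞ :=
  ringKrullDim (R ⧸ Module.annihilator R M)


section Part1
open IsLocalRing

section CompletionNoeth

open Ideal in
theorem exists_maximal_not_fg {R : Type u} [CommRing R] (h : ¬ IsNoetherianRing R) :
    ∃ P : Ideal R, Maximal (fun I : Ideal R => ¬ I.FG) P := by
  obtain ⟨I, hI⟩ : ∃ I : Ideal R, ¬ I.FG := by
    by_contra! hc
    exact h ⟨hc⟩
  obtain ⟨M, _, hM⟩ : ∃ M, I ≤ M ∧ Maximal (fun I : Ideal R => ¬ I.FG) M := by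
    refine zorn_le_nonempty₀ {I : Ideal R | ¬ I.FG}
      (fun C hC₁ hC₂ J hJ ↦ ⟨sSup C, ?_, fun _ ↦ le_sSup⟩) I hI
    intro h
    obtain ⟨G, hG⟩ := h
    obtain ⟨J, J_mem_C, G_subset_J⟩ : ∃ J ∈ C, (G : Set R) ⊆ J := by
      refine hC₂.directedOn.exists_mem_subset_of_finset_subset_biUnion ⟨J, hJ⟩ (fun _ hx ↦ ?_)
      simp only [Set.mem_iUnion, SetLike.mem_coe, exists_prop]
      exact (Submodule.mem_sSup_of_directed ⟨J, hJ⟩ hC₂.directedOn).1 <| hG ▸ subset_span hx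
    have J_eq_sSup : J = sSup C :=
      le_antisymm (le_sSup J_mem_C) (hG ▸ Ideal.span_le.2 G_subset_J)
    exact hC₁ J_mem_C (J_eq_sSup ▸ ⟨G, hG⟩)
  exact ⟨M, hM⟩

theorem noeth_of_complete {S : Type u} [CommRing S] [IsLocalRing S]
    (hfg : (maximalIdeal S).FG) [IsAdicComplete (maximalIdeal S) S] : IsNoetherianRing S := by
  by_contra hcon
  obtain ⟨P, hP⟩ := exists_maximal_not_fg hcon
  have hprime : P.IsPrime := Ideal.isOka_fg.isPrime_of_maximal_not hP
  have hle : P ≤ maximalIdeal S := le_maximalIdeal hprime.ne_top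
  obtain ⟨x, hx, hxP⟩ : ∃ x ∈ maximalIdeal S, x ∉ P := by
    by_contra! hc
    exact hP.prop ((le_antisymm hle hc) ▸ hfg)
  have hfg2 : (P ⊔ Ideal.span {x}).FG :=
    of_not_not <| hP.not_prop_of_gt (Submodule.lt_sup_iff_notMem.2 hxP)
  obtain ⟨k, f, hf⟩ := Submodule.fg_iff_exists_fin_generating_family.1 hfg2
  have H i : ∃ r : S, ∃ p ∈ P, r * x + p = f i := by
    apply Ideal.mem_span_singleton_sup.1
    rw [sup_comm, ← hf]
    exact Submodule.subset_span ⟨i, rfl⟩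
  choose r g hgP hg using H
  have step : ∀ p : P, ∃ (c : Fin k → S) (p' : P), (p : S) = ∑ i, c i * g i + x * p' := by
    intro p
    have : (p : S) ∈ Submodule.span S (Set.range f) := hf ▸ Ideal.mem_sup_left p.2
    obtain ⟨s, hs⟩ := (Submodule.mem_span_range_iff_exists_fun S).1 this
    have h2 : (p : S) = ∑ i, s i * g i + x * (∑ i, s i * r i) := by
      rw [← hs, Finset.mul_sum, ← Finset.sum_add_distrib]
      refine Finset.sum_congr rfl fun i _ => ?_
      rw [← hg i, smul_eq_mul]; ring
    have h3 : x * (∑ i, s i * r i) ∈ P := by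
      have : x * (∑ i, s i * r i) = p - ∑ i, s i * g i := by rw [h2]; ring
      rw [this]
      exact P.sub_mem p.2 (P.sum_mem fun i _ => P.mul_mem_left _ (hgP i))
    exact ⟨s, ⟨_, (hprime.mem_or_mem h3).resolve_left hxP⟩, h2⟩
  choose c nx hc using step
  have hPle : P = Ideal.span (Set.range g) := by
    apply le_antisymm
    · intro p hp
      let q : ℕ → P := fun n => nx^[n] ⟨p, hp⟩
      have hq : ∀ n, (q n : S) = ∑ i, c (q n) i * g i + x * q (n+1) := by
        intro n
        rw [show q (n+1) = nx (q n) from Function.iterate_succ_apply' _ _ _]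
        exact hc _
      let a : Fin k → ℕ → S := fun i n => ∑ j ∈ Finset.range n, x ^ j * c (q j) i
      have ha : ∀ n, p = ∑ i, a i n * g i + x ^ n * q n := by
        intro n
        induction n with
        | zero => simp [a, q]
        | succ n ih =>
          conv_lhs => rw [ih, hq n]
          simp only [a, Finset.sum_range_succ, add_mul, Finset.sum_add_distrib, mul_add,
            Finset.mul_sum]
          rw [pow_succ, ← add_assoc]
          congr 1
          · congr 1
            exact Finset.sum_congr rfl fun i _ => by ring
          · ring
      have hcau : ∀ i, ∃ L, ∀ n, a i n ≡ L [SMOD (maximalIdeal S) ^ n • (⊤ : Ideal S)] := by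
        intro i
        apply IsPrecomplete.prec (inferInstance : IsPrecomplete (maximalIdeal S) S)
        intro m n hmn
        rw [SModEq.comm, SModEq.sub_mem]
        simp only [a]
        rw [← Finset.sum_Ico_eq_sub _ hmn]
        refine Submodule.sum_mem _ fun j hj => ?_
        rw [smul_eq_mul, Ideal.mul_top]
        exact Ideal.mul_mem_right _ _ (Ideal.pow_le_pow_right (Finset.mem_Ico.1 hj).1
          (Ideal.pow_mem_pow hx j))
      choose L hL using hcau
      have : p - ∑ i, L i * g i = 0 := by
        apply IsHausdorff.haus (inferInstance : IsHausdorff (maximalIdeal S) S)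
        intro n
        rw [SModEq.sub_mem, sub_zero, smul_eq_mul, Ideal.mul_top]
        have : p - ∑ i, L i * g i = ∑ i, (a i n - L i) * g i + x ^ n * q n := by
          conv_lhs => rw [ha n]
          simp only [sub_mul, Finset.sum_sub_distrib]; ring
        rw [this]
        refine add_mem (sum_mem fun i _ => ?_) (Ideal.mul_mem_right _ _ (Ideal.pow_mem_pow hx n))
        refine Ideal.mul_mem_right _ _ ?_
        have := (hL i n)
        rwa [SModEq.sub_mem, smul_eq_mul, Ideal.mul_top] at this
      rw [sub_eq_zero.1 this]
      exact sum_mem fun i _ => Ideal.mul_mem_left _ _ (Ideal.subset_span ⟨i, rfl⟩)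
    · rw [Ideal.span_le]; rintro _ ⟨i, rfl⟩; exact hgP i
  exact hP.prop (hPle ▸ Submodule.fg_span (Set.finite_range g))

instance completion_noeth {R : Type u} [CommRing R] [IsNoetherianRing R] [IsLocalRing R] :
    IsNoetherianRing (AdicCompletion (maximalIdeal R) R) := by
  apply noeth_of_complete
  rw [AdicCompletion.maximalIdeal_eq_map]
  exact Ideal.FG.map (IsNoetherian.noetherian _) _

end CompletionNoeth

end Part1

section Part2
open IsLocalRing CategoryTheory

section Matlis

theorem exists_injective_embedding {S : Type u} [CommRing S] (X : Type u) [AddCommGroup X]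
    [Module S X] : ∃ (I : Type u) (_ : AddCommGroup I) (_ : Module S I) (f : X →ₗ[S] I),
      Module.Injective S I ∧ Function.Injective f := by
  let J := Injective.under (ModuleCat.of S X)
  refine ⟨J, inferInstance, inferInstance, (Injective.ι (ModuleCat.of S X)).hom, ?_, ?_⟩
  · exact Module.injective_module_of_injective_object S J (inj := (inferInstanceAs (Injective J)))
  · exact (ModuleCat.mono_iff_injective _).1 (inferInstance : Mono (Injective.ι (ModuleCat.of S X)))

/-- an injective module with simple socle generated by `e` -/
structure IsE (S : Type u) [CommRing S] [IsLocalRing S] (E : Type u) [AddCommGroup E]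
    [Module S E] (e : E) : Prop where
  inj : Module.Injective S E
  ne : e ≠ 0
  soc : ∀ z : E, (∀ s ∈ maximalIdeal S, s • z = 0) ↔ ∃ s : S, z = s • e

variable {S : Type u} [CommRing S] [IsLocalRing S]

theorem exists_isE (S : Type u) [CommRing S] [IsLocalRing S] :
    ∃ (E : Type u) (_ : AddCommGroup E) (_ : Module S E) (e : E), IsE S E e := by
  obtain ⟨I, _, _, f, hI, hf⟩ := exists_injective_embedding (S := S) (ResidueField S)
  set e := f 1 with he
  have he0 : e ≠ 0 := by
    intro h
    have : (1 : ResidueField S) = 0 := hf (by rw [← he, h, map_zero])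
    exact one_ne_zero this
  have hme : ∀ s ∈ maximalIdeal S, s • e = 0 := by
    intro s hs
    rw [he, ← map_smul]
    have : s • (1 : ResidueField S) = 0 := by
      rw [Algebra.smul_def, mul_one]
      exact (residue_eq_zero_iff s).2 hs
    rw [this, map_zero]
  -- maximal essential
  let Q : Set (Submodule S I) := {N | ∀ n ∈ N, n ≠ 0 → ∃ s : S, s • n = e}
  have h0 : Submodule.span S {e} ∈ Q := by
    intro n hn hn0
    obtain ⟨s, rfl⟩ := Submodule.mem_span_singleton.1 hn
    have hs : IsUnit s := by
      by_contra hc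
      exact hn0 (hme s hc)
    obtain ⟨u, rfl⟩ := hs
    exact ⟨↑u⁻¹, by rw [smul_smul]; simp⟩
  obtain ⟨E, hE1, hE⟩ : ∃ E, Submodule.span S {e} ≤ E ∧ Maximal (· ∈ Q) E := by
    refine zorn_le_nonempty₀ Q (fun C hC₁ hC₂ J hJ ↦ ⟨sSup C, ?_, fun _ ↦ le_sSup⟩) _ h0
    intro n hn hn0
    obtain ⟨N, hN, hnN⟩ := (Submodule.mem_sSup_of_directed ⟨J, hJ⟩ hC₂.directedOn).1 hn
    exact hC₁ hN n hnN hn0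
  have heE : e ∈ E := hE1 (Submodule.mem_span_singleton_self e)
  obtain ⟨C, -, hC⟩ : ∃ C, (⊥ : Submodule S I) ≤ C ∧ Maximal (fun C : Submodule S I => e ∉ C) C := by
    refine zorn_le_nonempty₀ {C : Submodule S I | e ∉ C}
      (fun C hC₁ hC₂ J hJ ↦ ⟨sSup C, ?_, fun _ ↦ le_sSup⟩) _ (by simpa using he0)
    intro hn
    obtain ⟨N, hN, hnN⟩ := (Submodule.mem_sSup_of_directed ⟨J, hJ⟩ hC₂.directedOn).1 hn
    exact hC₁ hN hnN
  have hCz : ∀ w : I ⧸ C, w ≠ 0 → ∃ s : S, s • w = C.mkQ e := by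
    intro w hw
    obtain ⟨z, rfl⟩ := C.mkQ_surjective w
    have hz : z ∉ C := fun h => hw ((Submodule.Quotient.mk_eq_zero C).2 h)
    have := hC.not_prop_of_gt (Submodule.lt_sup_iff_notMem.2 hz)
    rw [not_not, Submodule.mem_sup] at this
    obtain ⟨c, hc, t, ht, hct⟩ := this
    obtain ⟨s, rfl⟩ := Submodule.mem_span_singleton.1 ht
    refine ⟨s, ?_⟩
    rw [← hct, map_add, map_smul]
    simp [hc]
  obtain ⟨h, hh⟩ := hI.out (C.mkQ ∘ₗ E.subtype) (by
    rw [← LinearMap.ker_eq_bot, LinearMap.ker_eq_bot']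
    intro m hm
    by_contra hm0
    obtain ⟨s, hs⟩ := hE.prop m.1 m.2 (by simpa using hm0)
    apply hC.prop
    rw [← hs]
    exact C.smul_mem _ ((Submodule.Quotient.mk_eq_zero C).1 hm)) E.subtype
  have hhe : h (C.mkQ e) = e := hh ⟨e, heE⟩
  have hrange : LinearMap.range h ∈ Q := by
    rintro _ ⟨w, rfl⟩ hw
    obtain ⟨s, hs⟩ := hCz w (by rintro rfl; simp at hw)
    exact ⟨s, by rw [← map_smul, hs, hhe]⟩
  have hEle : E ≤ LinearMap.range h := fun z hz => ⟨_, hh ⟨z, hz⟩⟩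
  have hrE : LinearMap.range h ≤ E := hE.le_of_ge hrange hEle
  let ret : I →ₗ[S] E := LinearMap.codRestrict E (h ∘ₗ C.mkQ) (fun i => hrE ⟨_, rfl⟩)
  refine ⟨E, inferInstance, inferInstance, ⟨e, heE⟩, ⟨?_⟩, ?_, ?_⟩
  · intro X Y _ _ _ _ f hf g
    obtain ⟨k, hk⟩ := hI.out f hf (E.subtype ∘ₗ g)
    refine ⟨ret ∘ₗ k, fun x => ?_⟩
    apply Subtype.ext
    simp only [LinearMap.comp_apply, hk, ret, LinearMap.codRestrict_apply]
    exact hh _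
  · simpa using he0
  · intro z
    constructor
    · intro hz
      by_cases hz0 : z = 0
      · exact ⟨0, by simp [hz0]⟩
      obtain ⟨s, hs⟩ := hE.prop z.1 z.2 (by simpa using hz0)
      have hsu : IsUnit s := by
        by_contra hc
        have := hz s hc
        apply he0
        rw [← hs]
        exact congrArg Subtype.val this
      obtain ⟨u, rfl⟩ := hsu
      refine ⟨↑u⁻¹, Subtype.ext ?_⟩
      simp [← hs, smul_smul]
    · rintro ⟨s, rfl⟩ t ht
      apply Subtype.ext
      simp [smul_comm t s, hme t ht]

variable {E : Type u} [AddCommGroup E] [Module S E] {e : E}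

theorem IsE.cogen (hE : IsE S E e) {Z : Type u} [AddCommGroup Z] [Module S Z] (z : Z)
    (hz : z ≠ 0) : ∃ f : Z →ₗ[S] E, f z ≠ 0 := by
  let j := (LinearMap.toSpanSingleton S Z z)
  let J := LinearMap.ker j
  have hJ : J ≤ LinearMap.ker (LinearMap.toSpanSingleton S E e) := by
    intro s hs
    have hs' : s • z = 0 := hs
    have : s ∈ maximalIdeal S := by
      rw [mem_maximalIdeal]
      intro hu
      exact hz ((hu.smul_eq_zero).1 hs')
    exact (hE.soc e).2 ⟨1, by simp⟩ s this
  obtain ⟨h, hh⟩ := hE.inj.out (J.liftQ j le_rfl) (by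
    rw [← LinearMap.ker_eq_bot, Submodule.ker_liftQ_eq_bot _ _ _ le_rfl]) (J.liftQ _ hJ)
  refine ⟨h, ?_⟩
  have : h (j 1) = LinearMap.toSpanSingleton S E e 1 := hh (J.mkQ 1)
  simp only [j, LinearMap.toSpanSingleton_apply, one_smul] at this
  rw [this]
  exact hE.ne

theorem IsE.bidual (hE : IsE S E e) [IsNoetherianRing S] {X : Type u} [AddCommGroup X] [Module S X]
    (hX : Module.Finite S X) (n : ℕ) (hn : ∀ s ∈ maximalIdeal S ^ n, ∀ x : X, s • x = 0)
    (φ : (X →ₗ[S] E) →ₗ[S] E) : ∃ x : X, ∀ f, φ f = f x := by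
  revert n φ
  refine IsNoetherianRing.induction_on_isQuotientEquivQuotientPrime S hX
    (motive := fun X _ _ _ => ∀ n, (∀ s ∈ maximalIdeal S ^ n, ∀ x : X, s • x = 0) →
      ∀ (φ : (X →ₗ[S] E) →ₗ[S] E), ∃ x : X, ∀ f, φ f = f x) ?_ ?_ ?_
  · intro N _ _ _ _ n hn φ
    refine ⟨0, fun f => ?_⟩
    have : f = 0 := by ext x; rw [Subsingleton.elim x 0]; simp
    simp [this]
  · intro N _ _ _ p eq n hn φ
    have hp : p.1 = maximalIdeal S := by
      have := p.2
      have h1 : maximalIdeal S ^ n ≤ p.1 := by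
        intro s hs
        have := hn s hs (eq.symm (Ideal.Quotient.mk _ 1))
        rw [← map_smul, LinearEquiv.map_eq_zero_iff] at this
        have h7 : Ideal.Quotient.mk p.1 (s * 1) = 0 := this
        rwa [Ideal.Quotient.eq_zero_iff_mem, mul_one] at h7
      exact le_antisymm (le_maximalIdeal p.2.ne_top) (Ideal.IsPrime.le_of_pow_le h1)
    set g : N := eq.symm (Ideal.Quotient.mk _ 1) with hg
    have hgen : ∀ x : N, ∃ s : S, x = s • g := by
      intro x
      obtain ⟨s, hs⟩ := Ideal.Quotient.mk_surjective (eq x)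
      refine ⟨s, ?_⟩
      apply eq.injective
      rw [map_smul, hg, LinearEquiv.apply_symm_apply, ← hs]
      conv_lhs => rw [← mul_one s]
      rfl
    have hmg : ∀ s ∈ maximalIdeal S, s • g = 0 := by
      intro s hs
      rw [hg, ← map_smul, LinearEquiv.map_eq_zero_iff]
      show Ideal.Quotient.mk p.1 (s * 1) = 0
      rw [Ideal.Quotient.eq_zero_iff_mem, mul_one, hp]; exact hs
    have hg0 : g ≠ 0 := by
      intro h
      rw [hg, LinearEquiv.map_eq_zero_iff, Ideal.Quotient.eq_zero_iff_mem] at h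
      exact p.2.ne_top ((Ideal.eq_top_iff_one _).2 h)
    obtain ⟨f0, hf0⟩ := hE.cogen g hg0
    have hsoc : ∀ f : N →ₗ[S] E, ∃ s : S, f g = s • e := by
      intro f
      exact (hE.soc _).1 fun s hs => by rw [← map_smul, hmg s hs, map_zero]
    -- normalise
    obtain ⟨u, hu⟩ := hsoc f0
    have huu : IsUnit u := by
      by_contra hc
      exact hf0 (by rw [hu]; exact (hE.soc e).2 ⟨1, by simp⟩ u hc)
    obtain ⟨t, ht⟩ : ∃ t : S, φ f0 = t • e := by
      refine (hE.soc _).1 fun s hs => ?_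
      rw [← map_smul]
      have : s • f0 = 0 := by
        ext x
        obtain ⟨r, rfl⟩ := hgen x
        simp [← map_smul, hmg s hs]
      rw [this, map_zero]
    obtain ⟨v, rfl⟩ := huu
    refine ⟨(t * ↑v⁻¹) • g, fun f => ?_⟩
    obtain ⟨s, hs⟩ := hsoc f
    have hf : f = (s * ↑v⁻¹) • f0 := by
      ext x
      obtain ⟨r, rfl⟩ := hgen x
      rw [map_smul, map_smul, LinearMap.smul_apply, hs, hu, smul_smul (s * _), mul_assoc]
      simp
    rw [map_smul, hs, hf, map_smul, ht, smul_smul, smul_smul]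
    congr 1; ring
  · intro X1 _ _ _ X2 _ _ _ X3 _ _ _ f g hf hg hfg h1 h3 n hn φ
    obtain ⟨x3, hx3⟩ := h3 n (fun s hs x => by
      obtain ⟨y, rfl⟩ := hg x; rw [← map_smul, hn s hs, map_zero]) (φ ∘ₗ LinearMap.lcomp S E g)
    obtain ⟨x2, rfl⟩ := hg x3
    let ψ : (X2 →ₗ[S] E) →ₗ[S] E := φ - LinearMap.applyₗ x2
    have hψ : LinearMap.ker (LinearMap.lcomp S E f) ≤ LinearMap.ker ψ := by
      intro k hk
      have hk' : ∀ x, k (f x) = 0 := fun x => LinearMap.congr_fun hk x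
      have hker : LinearMap.ker g ≤ LinearMap.ker k := by
        intro y hy
        obtain ⟨x, rfl⟩ := (hfg y).1 hy
        exact hk' x
      obtain ⟨k', hk'⟩ : ∃ k' : X3 →ₗ[S] E, k' ∘ₗ g = k := by
        refine ⟨(LinearMap.ker g).liftQ k hker ∘ₗ (g.quotKerEquivOfSurjective hg).symm.toLinearMap, ?_⟩
        ext y
        simp only [LinearMap.comp_apply, LinearEquiv.coe_coe]
        have : (g.quotKerEquivOfSurjective hg).symm (g y) = (LinearMap.ker g).mkQ y := by
          rw [LinearEquiv.symm_apply_eq]; rfl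
        rw [this]; simp
      have := hx3 k'
      simp only [LinearMap.comp_apply] at this
      rw [show (LinearMap.lcomp S E g) k' = k from hk'] at this
      simp only [ψ, LinearMap.mem_ker, LinearMap.sub_apply, this]
      simp [← hk']
    have hsurj : Function.Surjective (LinearMap.lcomp S E f) := by
      intro k
      obtain ⟨h, hh⟩ := hE.inj.out f hf k
      exact ⟨h, LinearMap.ext hh⟩
    let ψ' : (X1 →ₗ[S] E) →ₗ[S] E := (LinearMap.ker (LinearMap.lcomp S E f)).liftQ ψ hψ ∘ₗ
      ((LinearMap.lcomp S E f).quotKerEquivOfSurjective hsurj).symm.toLinearMap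
    have hψ' : ∀ k, ψ' (k ∘ₗ f) = ψ k := by
      intro k
      have : ((LinearMap.lcomp S E f).quotKerEquivOfSurjective hsurj).symm (k ∘ₗ f) =
          (LinearMap.ker (LinearMap.lcomp S E f)).mkQ k := by
        rw [LinearEquiv.symm_apply_eq]; rfl
      simp only [ψ', LinearMap.comp_apply, LinearEquiv.coe_coe]
      rw [this]; simp
    obtain ⟨x1, hx1⟩ := h1 n (fun s hs x => hf (by rw [map_smul, hn s hs, map_zero])) ψ'
    refine ⟨x2 + f x1, fun k => ?_⟩
    have h5 := hψ' k
    rw [hx1] at h5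
    simp only [ψ, LinearMap.sub_apply, LinearMap.applyₗ_apply_apply, LinearMap.comp_apply] at h5
    rw [map_add, h5]; abel


/-- faithful: an element killing `0 :_E m^n` lies in `m^n` -/
theorem IsE.faithful (hE : IsE S E e) (n : ℕ) (r : S)
    (h : ∀ z : E, (∀ s ∈ maximalIdeal S ^ n, s • z = 0) → r • z = 0) : r ∈ maximalIdeal S ^ n := by
  by_contra hr
  obtain ⟨f, hf⟩ := hE.cogen (Z := S ⧸ (maximalIdeal S ^ n)) (Ideal.Quotient.mk _ r)
    (by rwa [Ne, Ideal.Quotient.eq_zero_iff_mem])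
  apply hf
  have h1 : ∀ s : S, f (Ideal.Quotient.mk _ s) = s • f (Ideal.Quotient.mk _ 1) := by
    intro s
    rw [← map_smul]
    congr 1
    conv_lhs => rw [← mul_one s]
    rfl
  rw [h1]
  apply h
  intro s hs
  rw [← h1, Ideal.Quotient.eq_zero_iff_mem.2 hs, map_zero]

theorem IsE.endo (hE : IsE S E e) [IsNoetherianRing S] [IsAdicComplete (maximalIdeal S) S]
    (φ : E →ₗ[S] E) : ∃ s : S, ∀ (n : ℕ) (z : E), (∀ r ∈ maximalIdeal S ^ n, r • z = 0) →
      φ z = s • z := by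
  have key : ∀ n, ∃ s : S, ∀ z : E, (∀ r ∈ maximalIdeal S ^ n, r • z = 0) → φ z = s • z := by
    intro n
    let X := S ⧸ (maximalIdeal S ^ n)
    have hX : Module.Finite S X := inferInstance
    obtain ⟨x, hx⟩ := hE.bidual hX n (fun s hs x => by
      obtain ⟨r, rfl⟩ := Ideal.Quotient.mk_surjective x
      show Ideal.Quotient.mk _ (s * r) = 0
      rw [Ideal.Quotient.eq_zero_iff_mem]
      exact Ideal.mul_mem_right _ _ hs) (φ ∘ₗ LinearMap.applyₗ (Ideal.Quotient.mk _ 1 : X))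
    obtain ⟨s, rfl⟩ := Ideal.Quotient.mk_surjective x
    refine ⟨s, fun z hz => ?_⟩
    let f : X →ₗ[S] E := Submodule.liftQ _ (LinearMap.toSpanSingleton S E z) (fun r hr => hz r hr)
    have hf : ∀ r, f (Ideal.Quotient.mk _ r) = r • z := fun r => rfl
    have := hx f
    simp only [LinearMap.comp_apply, LinearMap.applyₗ_apply_apply, hf, one_smul] at this
    exact this
  choose s hs using key
  have hcoh : ∀ {m n : ℕ}, m ≤ n → s m ≡ s n [SMOD (maximalIdeal S) ^ m • (⊤ : Ideal S)] := by
    intro m n hmn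
    rw [SModEq.sub_mem, smul_eq_mul, Ideal.mul_top]
    apply hE.faithful
    intro z hz
    rw [sub_smul, ← hs m z hz, ← hs n z (fun r hr => hz r (Ideal.pow_le_pow_right hmn hr)), sub_self]
  obtain ⟨L, hL⟩ := IsPrecomplete.prec (inferInstance : IsPrecomplete (maximalIdeal S) S) hcoh
  refine ⟨L, fun n z hz => ?_⟩
  have := hL n
  rw [SModEq.sub_mem, smul_eq_mul, Ideal.mul_top] at this
  rw [hs n z hz, ← sub_eq_zero, ← sub_smul]
  exact hz _ this

theorem artinian_torsion [IsNoetherianRing S] {A : Type u} [AddCommGroup A] [Module S A]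
    [IsArtinian S A] (a : A) : ∃ n : ℕ, ∀ s ∈ maximalIdeal S ^ n, s • a = 0 := by
  let f : ℕ →o (Submodule S A)ᵒᵈ := ⟨fun n => OrderDual.toDual ((maximalIdeal S ^ n) • (Submodule.span S {a})), by
    intro m n hmn
    exact Submodule.smul_mono_left (Ideal.pow_le_pow_right hmn)⟩
  obtain ⟨n, hn⟩ := IsArtinian.monotone_stabilizes f
  have h1 := hn (n+1) (Nat.le_succ n)
  have h1 : (maximalIdeal S ^ n) • (Submodule.span S {a}) =
    (maximalIdeal S ^ (n+1)) • (Submodule.span S {a}) := h1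
  have h2 : (maximalIdeal S ^ n) • (Submodule.span S {a}) = ⊥ := by
    apply Submodule.eq_bot_of_le_smul_of_le_jacobson_bot (maximalIdeal S)
    · exact Submodule.FG.smul (IsNoetherian.noetherian _) (Submodule.fg_span_singleton a)
    · rw [smul_smul, ← pow_succ', ← h1]
    · exact (IsLocalRing.jacobson_eq_maximalIdeal ⊥ bot_ne_top).ge
  refine ⟨n, fun s hs => ?_⟩
  have : s • a ∈ (maximalIdeal S ^ n) • (Submodule.span S {a}) :=
    Submodule.smul_mem_smul hs (Submodule.mem_span_singleton_self a)
  rw [h2] at this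
  simpa using this

theorem IsE.embed (hE : IsE S E e) {A : Type u} [AddCommGroup A] [Module S A]
    [IsArtinian S A] : ∃ (r : ℕ) (f : Fin r → (A →ₗ[S] E)), ∀ a, (∀ i, f i a = 0) → a = 0 := by
  classical
  let Q : Set (Submodule S A) := {K | ∃ (r : ℕ) (f : Fin r → (A →ₗ[S] E)),
    ∀ a, (∀ i, f i a = 0) → a ∈ K}
  obtain ⟨K, ⟨r, f, hf⟩, hmin⟩ := IsArtinian.set_has_minimal Q ⟨⊤, 0, Fin.elim0, by simp⟩
  refine ⟨r, f, fun a ha => ?_⟩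
  by_contra ha0
  obtain ⟨g, hg⟩ := hE.cogen a ha0
  refine hmin (K ⊓ LinearMap.ker g) ⟨r+1, Fin.cons g f, fun b hb => ⟨?_, ?_⟩⟩ ?_
  · exact hf b fun i => by simpa using hb i.succ
  · simpa using hb 0
  · refine lt_of_le_of_ne inf_le_left fun h => ?_
    have h2 := hf a ha
    rw [← h] at h2
    exact hg h2.2

/-- Lemma N -/
theorem lemmaN [IsNoetherianRing S] [IsAdicComplete (maximalIdeal S) S]
    {A : Type u} [AddCommGroup A] [Module S A] [IsArtinian S A] (c y : S)
    (h : ∀ a : A, c • a = 0 → y • a = 0) :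
    ∃ r : ℕ, y ^ r ∈ Module.annihilator S A ⊔ Ideal.span {c} := by
  classical
  obtain ⟨E, _, _, e, hE⟩ := exists_isE S
  obtain ⟨r, f, hf⟩ := hE.embed (A := A)
  let K := LinearMap.ker (LinearMap.lsmul S A c)
  have hK : ∀ a, a ∈ K ↔ c • a = 0 := fun a => by simp [K]
  let ι : A →ₗ[S] (Fin r → E) := LinearMap.pi f
  let j : (A ⧸ K) →ₗ[S] (Fin r → E) := K.liftQ (c • ι) (fun a ha => by
    rw [LinearMap.mem_ker, LinearMap.smul_apply, ← map_smul, (hK a).1 ha, map_zero])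
  have hj : Function.Injective j := by
    rw [← LinearMap.ker_eq_bot, LinearMap.ker_eq_bot']
    intro w hw
    obtain ⟨a, rfl⟩ := K.mkQ_surjective w
    have h1 : c • ι a = 0 := hw
    rw [← map_smul] at h1
    have h2 : c • a = 0 := hf _ fun i => congrFun h1 i
    exact (Submodule.Quotient.mk_eq_zero K).2 ((hK a).2 h2)
  have hext : ∀ i, ∃ Ψ : (Fin r → E) →ₗ[S] E, ∀ a, Ψ (c • ι a) = y • f i a := by
    intro i
    obtain ⟨Ψ, hΨ⟩ := hE.inj.out j hj (K.liftQ (y • f i) (fun a ha => by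
      rw [LinearMap.mem_ker, LinearMap.smul_apply, ← map_smul, h a ((hK a).1 ha), map_zero]))
    exact ⟨Ψ, fun a => hΨ (K.mkQ a)⟩
  choose Ψ hΨ using hext
  have hend : ∀ i l, ∃ s : S, ∀ (n : ℕ) (z : E), (∀ r ∈ maximalIdeal S ^ n, r • z = 0) →
      (Ψ i ∘ₗ LinearMap.single S (fun _ => E) l) z = s • z := fun i l => hE.endo _
  choose s hs using hend
  let B : Matrix (Fin r) (Fin r) S := Matrix.of fun i l => (if i = l then y else 0) - c * s i l
  have hB : ∀ a i, ∑ l, B i l • f l a = 0 := by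
    intro a i
    obtain ⟨n, hn⟩ := artinian_torsion (S := S) a
    have hz : ∀ l, ∀ r ∈ maximalIdeal S ^ n, r • f l a = 0 := fun l r hr => by
      rw [← map_smul, hn r hr, map_zero]
    have h1 : Ψ i (ι a) = ∑ l, s i l • f l a := by
      conv_lhs => rw [← LinearMap.sum_single_apply (φ := fun _ => E) (ι a)]
      rw [map_sum]
      exact Finset.sum_congr rfl fun l _ => hs i l n (f l a) (hz l)
    have h2 := hΨ i a
    rw [map_smul, h1, Finset.smul_sum] at h2
    simp only [B, Matrix.of_apply, sub_smul, Finset.sum_sub_distrib, ite_smul, zero_smul,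
      Finset.sum_ite_eq, Finset.mem_univ, if_true, mul_smul]
    rw [h2, sub_self]
  have hdet : B.det ∈ Module.annihilator S A := by
    rw [Module.mem_annihilator]
    intro a
    apply hf
    intro i
    rw [map_smul]
    have h1 : ∑ l, (B.adjugate * B) i l • f l a = B.det • f i a := by
      rw [Matrix.adjugate_mul]
      simp [Matrix.smul_apply, Matrix.one_apply]
    rw [← h1]
    simp only [Matrix.mul_apply, Finset.sum_smul]
    rw [Finset.sum_comm]
    apply Finset.sum_eq_zero
    intro k _
    simp only [mul_smul]
    rw [← Finset.smul_sum, hB, smul_zero]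
  refine ⟨r, ?_⟩
  have hcong : Ideal.Quotient.mk (Ideal.span {c}) B.det = Ideal.Quotient.mk (Ideal.span {c}) (y ^ r) := by
    rw [RingHom.map_det]
    have : (Ideal.Quotient.mk (Ideal.span {c})).mapMatrix B =
        Matrix.scalar (Fin r) (Ideal.Quotient.mk (Ideal.span {c}) y) := by
      ext i l
      have hc : Ideal.Quotient.mk (Ideal.span {c}) c = 0 :=
        Ideal.Quotient.eq_zero_iff_mem.2 (Ideal.mem_span_singleton_self c)
      by_cases hil : i = l
      · simp [B, hc, Matrix.diagonal_apply, hil]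
      · simp [B, hc, Matrix.diagonal_apply, hil]
    rw [this]
    simp
  rw [Ideal.Quotient.eq] at hcong
  have : y ^ r = B.det - (B.det - y ^ r) := by ring
  rw [this]
  exact sub_mem (Ideal.mem_sup_left hdet) (Ideal.mem_sup_right hcong)

end Matlis

end Part2

section Part3
open IsLocalRing CategoryTheory

theorem lemmaArt {S : Type u} [CommRing S] {A : Type u} [AddCommGroup A] [Module S A] (c : S)
    (htor : ∀ a : A, ∃ n : ℕ, c ^ n • a = 0)
    (hK : IsArtinian S (LinearMap.ker (LinearMap.lsmul S A c))) : IsArtinian S A := by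
  rw [← monotone_stabilizes_iff_artinian]
  intro f
  let B : ℕ → Submodule S A := fun j => OrderDual.ofDual (f j)
  have hB : ∀ {i j}, i ≤ j → B j ≤ B i := fun {i j} h => f.monotone h
  let K := LinearMap.ker (LinearMap.lsmul S A c)
  let U : ℕ → ℕ → Submodule S K := fun n j =>
    Submodule.comap K.subtype
      ((B j ⊓ LinearMap.ker (LinearMap.lsmul S A (c ^ (n+1)))).map (LinearMap.lsmul S A (c ^ n)))
  have hU : ∀ n j (k : K), k ∈ U n j ↔ ∃ z ∈ B j, c ^ (n+1) • z = 0 ∧ c ^ n • z = k := by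
    intro n j k
    simp [U, and_assoc]
  have hUj : ∀ n i j, i ≤ j → U n j ≤ U n i := by
    intro n i j hij k hk
    rw [hU] at hk ⊢
    obtain ⟨z, hz, h⟩ := hk
    exact ⟨z, hB hij hz, h⟩
  have hUn : ∀ n m j, n ≤ m → U m j ≤ U n j := by
    intro n m j hnm k hk
    rw [hU] at hk ⊢
    obtain ⟨z, hz, h1, h2⟩ := hk
    obtain ⟨t, rfl⟩ := Nat.exists_eq_add_of_le hnm
    refine ⟨c ^ t • z, (B j).smul_mem _ hz, ?_, ?_⟩
    · rw [smul_smul, ← pow_add, ← h1]; congr 2; ring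
    · rw [smul_smul, ← pow_add, h2]
  obtain ⟨W, ⟨⟨n0, j0⟩, rfl⟩, hmin⟩ := IsArtinian.set_has_minimal
    (Set.range fun p : ℕ × ℕ => U p.1 p.2) ⟨_, ⟨(0, 0), rfl⟩⟩
  have hst : ∀ n j, n0 ≤ n → j0 ≤ j → U n j = U n0 j0 := by
    intro n j hn hj
    have h1 : U n j ≤ U n0 j0 := (hUn _ _ _ hn).trans (hUj _ _ _ hj)
    by_contra hne
    exact hmin (U n j) ⟨(n, j), rfl⟩ (lt_of_le_of_ne h1 hne)
  have hs2 : ∀ n, ∃ j1, ∀ j, j1 ≤ j → U n j = U n j1 := by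
    intro n
    obtain ⟨j1, hj1⟩ := IsArtinian.monotone_stabilizes
      (⟨fun j => OrderDual.toDual (U n j), fun i j h => hUj n i j h⟩ : ℕ →o (Submodule S K)ᵒᵈ)
    exact ⟨j1, fun j hj => (hj1 j hj).symm⟩
  choose g hg using hs2
  let J := j0 + (Finset.range n0).sup g
  have hJ : ∀ n j, J ≤ j → U n j = U n J := by
    intro n j hj
    by_cases hn : n0 ≤ n
    · rw [hst n j hn (by omega), hst n J hn (by omega)]
    · have : g n ≤ (Finset.range n0).sup g := Finset.le_sup (by simpa using hn)
      rw [hg n j (by omega), hg n J (by omega)]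
  refine ⟨J, fun j hj => ?_⟩
  have key : ∀ n, ∀ z ∈ B J, c ^ n • z = 0 → z ∈ B j := by
    intro n
    induction n with
    | zero => intro z _ hz; simp at hz; simp [hz]
    | succ n ih =>
      intro z hz hz0
      have hk : c ^ n • z ∈ K := by
        simp only [K, LinearMap.mem_ker, LinearMap.lsmul_apply, smul_smul]
        rw [← pow_succ', hz0]
      have h1 : (⟨_, hk⟩ : K) ∈ U n J := (hU _ _ _).2 ⟨z, hz, hz0, rfl⟩
      rw [← hJ n j hj, hU] at h1
      obtain ⟨z', hz', h2, h3⟩ := h1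
      have := ih (z - z') ((B J).sub_mem hz (hB hj hz')) (by rw [smul_sub, h3, sub_self])
      have h4 := (B j).add_mem this hz'
      simpa using h4
  show B J = B j
  refine le_antisymm (fun z hz => ?_) (hB hj)
  obtain ⟨n, hn⟩ := htor z
  exact key n z hz hn

end Part3

section Part4
open IsLocalRing CategoryTheory

/-- abstract data for local cohomology -/
structure LCD (S : Type u) [CommRing S] (a : Ideal S) where
  H : ℕ → ModuleCat.{u} S ⥤ ModuleCat.{u} S
  map_smul : ∀ (i : ℕ) {X Y : ModuleCat.{u} S} (s : S) (f : X ⟶ Y),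
    (H i).map (s • f) = s • (H i).map f
  map_add : ∀ (i : ℕ) {X Y : ModuleCat.{u} S} (f g : X ⟶ Y),
    (H i).map (f + g) = (H i).map f + (H i).map g
  exact : ∀ (i : ℕ) {X Y Z : Type u} [AddCommGroup X] [AddCommGroup Y] [AddCommGroup Z]
    [Module S X] [Module S Y] [Module S Z] (f : X →ₗ[S] Y) (g : Y →ₗ[S] Z),
    Function.Injective f → Function.Exact f g → Function.Surjective g →
    Function.Exact ((H i).map (ModuleCat.ofHom f)) ((H i).map (ModuleCat.ofHom g))
  delta : ∀ (i : ℕ) {X Y Z : Type u} [AddCommGroup X] [AddCommGroup Y] [AddCommGroup Z]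
    [Module S X] [Module S Y] [Module S Z] (f : X →ₗ[S] Y) (g : Y →ₗ[S] Z),
    Function.Injective f → Function.Exact f g → Function.Surjective g →
    ∃ δ : (H i).obj (ModuleCat.of S Z) →ₗ[S] (H (i+1)).obj (ModuleCat.of S X),
      Function.Exact ((H i).map (ModuleCat.ofHom g)) δ ∧
      Function.Exact δ ((H (i+1)).map (ModuleCat.ofHom f)) ∧
      ∀ (α : X →ₗ[S] X) (β : Y →ₗ[S] Y) (γ : Z →ₗ[S] Z), f ∘ₗ α = β ∘ₗ f → g ∘ₗ β = γ ∘ₗ g →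
        ∀ e, δ ((H i).map (ModuleCat.ofHom γ) e) = (H (i+1)).map (ModuleCat.ofHom α) (δ e)
  inj0 : ∀ {X Y : Type u} [AddCommGroup X] [AddCommGroup Y] [Module S X] [Module S Y]
    (f : X →ₗ[S] Y), Function.Injective f → Function.Injective ((H 0).map (ModuleCat.ofHom f))
  p0 : ∀ (X : Type u) [AddCommGroup X] [Module S X],
    ∃ j : (H 0).obj (ModuleCat.of S X) →ₗ[S] X, Function.Injective j ∧
      ∀ (α : X →ₗ[S] X) e, j ((H 0).map (ModuleCat.ofHom α) e) = α (j e)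
  tors : ∀ (i : ℕ) (X : ModuleCat.{u} S) (e : (H i).obj X), ∃ n : ℕ, ∀ r ∈ a ^ n, r • e = 0
  p4 : ∀ (i : ℕ) (X : Type u) [AddCommGroup X] [Module S X],
    (∀ x : X, ∃ n : ℕ, ∀ r ∈ a ^ n, r • x = 0) → Subsingleton ((H (i+1)).obj (ModuleCat.of S X))

namespace LCD

section basics
variable {S : Type u} [CommRing S] {a : Ideal S} (D : LCD S a)

/-- the cohomology module of an unbundled module -/
abbrev M (i : ℕ) (X : Type u) [AddCommGroup X] [Module S X] : Type u :=
  (D.H i).obj (ModuleCat.of S X)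

/-- the map on cohomology -/
def map (i : ℕ) {X Y : Type u} [AddCommGroup X] [AddCommGroup Y] [Module S X] [Module S Y]
    (f : X →ₗ[S] Y) : D.M i X →ₗ[S] D.M i Y := ((D.H i).map (ModuleCat.ofHom f)).hom

variable {X Y Z : Type u} [AddCommGroup X] [AddCommGroup Y] [AddCommGroup Z]
    [Module S X] [Module S Y] [Module S Z]

theorem map_comp (i : ℕ) (f : X →ₗ[S] Y) (g : Y →ₗ[S] Z) (h : D.M i X) :
    D.map i (g ∘ₗ f) h = D.map i g (D.map i f h) := by
  simp [map, ModuleCat.ofHom_comp]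

theorem map_id (i : ℕ) (h : D.M i X) : D.map i (LinearMap.id : X →ₗ[S] X) h = h := by
  simp only [map, ModuleCat.ofHom_id, CategoryTheory.Functor.map_id]; rfl

theorem map_smul' (i : ℕ) (s : S) (f : X →ₗ[S] Y) (h : D.M i X) :
    D.map i (s • f) h = s • D.map i f h := by
  have := D.map_smul i s (ModuleCat.ofHom f)
  simp only [map]
  rw [show ModuleCat.ofHom (s • f) = s • ModuleCat.ofHom f from rfl, this]
  rfl

theorem map_smul_id (i : ℕ) (s : S) (h : D.M i X) :
    D.map i (s • (LinearMap.id : X →ₗ[S] X)) h = s • h := by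
  rw [map_smul', map_id]

/-- functoriality for isomorphisms -/
def equiv (i : ℕ) (e : X ≃ₗ[S] Y) : D.M i X ≃ₗ[S] D.M i Y :=
  LinearEquiv.ofLinearMap (D.map i e.toLinearMap) (D.map i e.symm.toLinearMap)
    (by ext h; simp [← map_comp, map_id]) (by ext h; simp [← map_comp, map_id])

theorem exact' (i : ℕ) {f : X →ₗ[S] Y} {g : Y →ₗ[S] Z} (hf : Function.Injective f)
    (hfg : Function.Exact f g) (hg : Function.Surjective g) :
    Function.Exact (D.map i f) (D.map i g) := D.exact i f g hf hfg hg

theorem delta' (i : ℕ) {f : X →ₗ[S] Y} {g : Y →ₗ[S] Z} (hf : Function.Injective f)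
    (hfg : Function.Exact f g) (hg : Function.Surjective g) :
    ∃ δ : D.M i Z →ₗ[S] D.M (i+1) X, Function.Exact (D.map i g) δ ∧
      Function.Exact δ (D.map (i+1) f) :=
  (D.delta i f g hf hfg hg).imp fun _ h => ⟨h.1, h.2.1⟩

theorem ann_le (i : ℕ) (X : Type u) [AddCommGroup X] [Module S X] :
    Module.annihilator S X ≤ Module.annihilator S (D.M i X) := by
  intro s hs
  rw [Module.mem_annihilator] at hs ⊢
  intro h
  rw [← D.map_smul_id]
  have : s • (LinearMap.id : X →ₗ[S] X) = (0 : S) • LinearMap.id := by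
    ext x; simp [hs x]
  rw [this, map_smul', zero_smul]

theorem sub_of_sub (i : ℕ) (X : Type u) [AddCommGroup X] [Module S X] [Subsingleton X] :
    Subsingleton (D.M i X) := by
  have h : (1 : S) ∈ Module.annihilator S X := by
    rw [Module.mem_annihilator]; intro m; exact Subsingleton.elim _ _
  have := D.ann_le i X h
  rw [Module.mem_annihilator] at this
  exact ⟨fun x y => by rw [← one_smul S x, ← one_smul S y, this, this]⟩

theorem sub_mid (i : ℕ) {f : X →ₗ[S] Y} {g : Y →ₗ[S] Z} (hf : Function.Injective f)
    (hfg : Function.Exact f g) (hg : Function.Surjective g) (h1 : Subsingleton (D.M i X))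
    (h3 : Subsingleton (D.M i Z)) : Subsingleton (D.M i Y) := by
  refine subsingleton_of_forall_eq 0 fun y => ?_
  obtain ⟨x, rfl⟩ := (D.exact' i hf hfg hg y).1 (Subsingleton.elim _ _)
  rw [Subsingleton.elim x 0, _root_.map_zero]

end basics

section torsion
variable {S : Type u} [CommRing S]

/-- the `a`-torsion submodule -/
def Gam (a : Ideal S) (X : Type u) [AddCommGroup X] [Module S X] : Submodule S X where
  carrier := {x | ∃ n : ℕ, ∀ r ∈ a ^ n, r • x = 0}
  zero_mem' := ⟨0, by simp⟩
  add_mem' := by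
    rintro x y ⟨n, hn⟩ ⟨m, hm⟩
    refine ⟨n + m, fun r hr => ?_⟩
    rw [smul_add, hn r (Ideal.pow_le_pow_right (by omega) hr),
      hm r (Ideal.pow_le_pow_right (by omega) hr), add_zero]
  smul_mem' := by
    rintro s x ⟨n, hn⟩
    exact ⟨n, fun r hr => by rw [smul_comm, hn r hr, smul_zero]⟩

theorem mem_Gam {a : Ideal S} {X : Type u} [AddCommGroup X] [Module S X] {x : X} :
    x ∈ Gam a X ↔ ∃ n : ℕ, ∀ r ∈ a ^ n, r • x = 0 := Iff.rfl

variable [IsNoetherianRing S]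

theorem Gam_quot (a : Ideal S) (X : Type u) [AddCommGroup X] [Module S X]
    (w : X ⧸ Gam a X) (n : ℕ) (hw : ∀ r ∈ a ^ n, r • w = 0) : w = 0 := by
  classical
  obtain ⟨x, rfl⟩ := (Gam a X).mkQ_surjective w
  have h1 : ∀ r ∈ a ^ n, r • x ∈ Gam a X := by
    intro r hr
    have := hw r hr
    rw [← _root_.map_smul] at this
    exact (Submodule.Quotient.mk_eq_zero _).1 this
  obtain ⟨G, hG⟩ := IsNoetherian.noetherian (a ^ n)
  have h2 : ∀ g : G, ∃ k : ℕ, ∀ r ∈ a ^ k, r • (g : S) • x = 0 := by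
    intro g
    exact h1 g.1 (hG ▸ Submodule.subset_span g.2)
  choose k hk using h2
  refine (Submodule.Quotient.mk_eq_zero _).2 ⟨(Finset.univ.sup k) + n, fun r hr => ?_⟩
  rw [pow_add] at hr
  refine Submodule.mul_induction_on hr ?_ ?_
  · intro s hs t ht
    rw [mul_smul]
    rw [← hG] at ht
    refine Submodule.span_induction (p := fun t _ => s • t • x = 0) ?_ ?_ ?_ ?_ ht
    · intro g hg
      exact hk ⟨g, hg⟩ s (Ideal.pow_le_pow_right (Finset.le_sup (Finset.mem_univ _)) hs)
    · simp
    · intro t1 t2 _ _ h1 h2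
      rw [add_smul, smul_add, h1, h2, add_zero]
    · intro b t _ h
      rw [smul_assoc, smul_comm s b, h, smul_zero]
  · intro s t hs ht
    rw [add_smul, hs, ht, add_zero]

theorem exists_regular (a : Ideal S) (X : Type u) [AddCommGroup X] [Module S X] [Module.Finite S X]
    (h : ∀ x : X, ∀ n : ℕ, (∀ r ∈ a ^ n, r • x = 0) → x = 0) : ∃ c ∈ a, IsSMulRegular X c := by
  by_contra hcon
  push Not at hcon
  have h1 : (a : Set S) ⊆ ⋃ p ∈ associatedPrimes S X, (p : Set S) := by
    rw [biUnion_associatedPrimes_eq_compl_regular]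
    intro c hc
    exact hcon c hc
  have h2 := (Ideal.subset_union_prime_finite (associatedPrimes.finite S X) (f := id) ⊥ ⊥
    (fun p hp _ _ => hp.isPrime)).1 (by simpa using h1)
  obtain ⟨p, hp, hle⟩ := h2
  obtain ⟨hpp, f, hf⟩ := (isAssociatedPrime_iff_exists_injective_linearMap p X).1 hp
  have h3 : f 1 = 0 := by
    refine h _ 1 fun r hr => ?_
    rw [pow_one] at hr
    rw [← _root_.map_smul, Algebra.smul_def, mul_one, Ideal.Quotient.algebraMap_eq,
      (Ideal.Quotient.eq_zero_iff_mem (I := p)).2 (hle hr), _root_.map_zero]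
  have h4 : (1 : S ⧸ p) = 0 := hf (by rw [h3, _root_.map_zero])
  rw [← _root_.map_one (Ideal.Quotient.mk p), Ideal.Quotient.eq_zero_iff_mem] at h4
  exact hpp.ne_top ((Ideal.eq_top_iff_one _).2 h4)

end torsion
end LCD

end Part4

section Part5
open IsLocalRing CategoryTheory
open scoped Pointwise

section dims
variable (S : Type u) [CommRing S]

/-- dimension strictly less than `k` -/
def dlt (X : Type u) [AddCommGroup X] [Module S X] (k : ℕ) : Prop :=
  Module.supportDim S X < (k : ℕ)

variable {S} {X Y : Type u} [AddCommGroup X] [Module S X] [AddCommGroup Y] [Module S Y]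

theorem dlt_mono {k l : ℕ} (h : dlt S X k) (hkl : k ≤ l) : dlt S X l :=
  lt_of_lt_of_le h (by exact_mod_cast hkl)

theorem dlt_of_surj {k : ℕ} (h : dlt S X k) (f : X →ₗ[S] Y) (hf : Function.Surjective f) :
    dlt S Y k := lt_of_le_of_lt (Module.supportDim_le_of_surjective f hf) h

theorem dlt_of_inj {k : ℕ} (h : dlt S Y k) (f : X →ₗ[S] Y) (hf : Function.Injective f) :
    dlt S X k := lt_of_le_of_lt (Module.supportDim_le_of_injective f hf) h

theorem supportDim_mono (h : Module.support S X ⊆ Module.support S Y) :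
    Module.supportDim S X ≤ Module.supportDim S Y :=
  Order.krullDim_le_of_strictMono (Set.inclusion h) (fun _ _ hab => hab)

theorem dlt_zero (h : dlt S X 0) : Subsingleton X := by
  rw [← Module.supportDim_eq_bot_iff_subsingleton S]
  unfold dlt at h
  generalize Module.supportDim S X = e at h
  induction e using WithBot.recBotCoe with
  | bot => rfl
  | coe e =>
    exfalso
    have : (e : WithBot ℕ∞) < ((0 : ℕ∞) : WithBot ℕ∞) := by simpa using h
    rw [WithBot.coe_lt_coe] at this
    simp at this

theorem wb_aux {e : WithBot ℕ∞} {k : ℕ} : e + 1 < ((k + 1 : ℕ) : WithBot ℕ∞) ↔ e < (k : ℕ) := by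
  induction e using WithBot.recBotCoe with
  | bot =>
    rw [WithBot.bot_add]
    exact ⟨fun _ => WithBot.bot_lt_coe (k : ℕ∞), fun _ => WithBot.bot_lt_coe ((k + 1 : ℕ) : ℕ∞)⟩
  | coe e =>
    have h1 : ((e : WithBot ℕ∞) + 1 < ((k + 1 : ℕ) : WithBot ℕ∞)) ↔
      (((e + 1 : ℕ∞) : WithBot ℕ∞) < (((k : ℕ∞) + 1 : ℕ∞) : WithBot ℕ∞)) := by
      push_cast; rfl
    have h2 : ((e : WithBot ℕ∞) < (k : ℕ)) ↔ ((e : WithBot ℕ∞) < ((k : ℕ∞) : WithBot ℕ∞)) := Iff.rfl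
    rw [h1, h2, WithBot.coe_lt_coe, WithBot.coe_lt_coe]
    exact (ENat.add_lt_add_iff_right (by simp))

variable [IsNoetherianRing S] [IsLocalRing S]

theorem dlt_quot [Module.Finite S X] {c : S} (hc : c ∈ maximalIdeal S) (hr : IsSMulRegular X c)
    {k : ℕ} (h : dlt S X (k + 1)) : dlt S (QuotSMulTop c X) k := by
  unfold dlt at h
  rw [← Module.supportDim_quotSMulTop_succ_eq_supportDim hr hc, wb_aux] at h
  exact h

theorem dlt_of_quot [Module.Finite S X] {c : S} (hc : c ∈ maximalIdeal S)
    {k : ℕ} (h : dlt S (QuotSMulTop c X) k) : dlt S X (k + 1) :=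
  lt_of_le_of_lt (Module.supportDim_le_supportDim_quotSMulTop_succ hc) (wb_aux.2 h)

theorem prime_eq_of_dlt_one [Module.Finite S X] (h : dlt S X 1) (q : Ideal S) [hq : q.IsPrime]
    (hle : Module.annihilator S X ≤ q) : q = maximalIdeal S := by
  have hmem : (⟨q, hq⟩ : PrimeSpectrum S) ∈ Module.support S X :=
    Module.mem_support_iff_of_finite.2 hle
  have h0 : Module.supportDim S X = 0 := by
    have hne : Module.supportDim S X ≠ ⊥ := by
      intro hb
      rw [Module.supportDim_eq_bot_iff_subsingleton] at hb
      rw [Module.support_eq_empty] at hmem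
      exact hmem
    unfold dlt at h
    generalize Module.supportDim S X = e at *
    induction e using WithBot.recBotCoe with
    | bot => exact absurd rfl hne
    | coe e =>
      have : (e : WithBot ℕ∞) < ((1 : ℕ∞) : WithBot ℕ∞) := by simpa using h
      rw [WithBot.coe_lt_coe, Order.lt_one_iff] at this
      rw [this]; rfl
  rw [support_of_supportDim_eq_zero S X h0] at hmem
  exact ((IsLocalRing.maximalIdeal.isMaximal S).eq_of_le hq.ne_top hmem).symm

theorem dlt_one [Module.Finite S X] (h : ∀ q : Ideal S, q.IsPrime → Module.annihilator S X ≤ q →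
    q = maximalIdeal S) : dlt S X 1 := by
  have h1 : Module.supportDim S X ≤ 0 := by
    have : Subsingleton (Module.support S X) := by
      refine ⟨fun p q => Subtype.ext (PrimeSpectrum.ext ?_)⟩
      rw [h p.1.1 p.1.2 (Module.mem_support_iff_of_finite.1 p.2),
        h q.1.1 q.1.2 (Module.mem_support_iff_of_finite.1 q.2)]
    exact Order.krullDim_nonpos_of_subsingleton
  exact lt_of_le_of_lt h1 (by simp)

theorem artin_of_primes [Module.Finite S X] (h : ∀ q : Ideal S, q.IsPrime →
    Module.annihilator S X ≤ q → q = maximalIdeal S) : IsArtinian S X := by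
  revert h
  have hsimp : IsSimpleModule S (S ⧸ maximalIdeal S) :=
    isSimpleModule_iff_isCoatom.2 (IsLocalRing.maximalIdeal.isMaximal S).out
  have hart : IsArtinian S (S ⧸ maximalIdeal S) := inferInstance
  refine IsNoetherianRing.induction_on_isQuotientEquivQuotientPrime S (M := X) inferInstance
    (motive := fun Y _ _ _ => (∀ q : Ideal S, q.IsPrime →
    Module.annihilator S Y ≤ q → q = maximalIdeal S) → IsArtinian S Y) ?_ ?_ ?_
  · intro N _ _ _ _ _
    exact isArtinian_of_injective (0 : N →ₗ[S] S ⧸ maximalIdeal S)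
      (fun x y _ => Subsingleton.elim x y)
  · intro N _ _ _ p e h
    have hp := h p.1 p.2 (by rw [e.annihilator_eq, Ideal.annihilator_quotient])
    rw [hp] at e
    exact isArtinian_of_linearEquiv e.symm
  · intro N₁ _ _ _ N₂ _ _ _ N₃ _ _ _ f g hf hg hfg h1 h3 h
    have a1 := h1 (fun q hq hle => h q hq ((f.annihilator_le_of_injective hf).trans hle))
    have a3 := h3 (fun q hq hle => h q hq ((g.annihilator_le_of_surjective hg).trans hle))
    exact isArtinian_of_range_eq_ker f g (LinearMap.exact_iff.1 hfg).symm
end dims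

namespace LCD
variable {S : Type u} [CommRing S] {a : Ideal S} (D : LCD S a)
variable [IsNoetherianRing S] [IsLocalRing S]

theorem reduce (ha : a ≤ maximalIdeal S) (X : Type u) [AddCommGroup X] [Module S X]
    [Module.Finite S X] :
    ∃ c ∈ a, ∃ (Q : Type u) (_ : AddCommGroup Q) (_ : Module S Q) (_ : Module.Finite S Q),
      (∀ k, dlt S X (k+1) → dlt S Q k) ∧ Module.annihilator S X ≤ Module.annihilator S Q ∧
      ∀ i, ∃ δ : D.M i Q →ₗ[S] D.M (i+1) X, ∀ e, c • e = 0 ↔ e ∈ LinearMap.range δ := by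
  obtain ⟨c, hca, hreg⟩ := exists_regular a (X ⧸ Gam a X) (fun w n h => Gam_quot a X w n h)
  refine ⟨c, hca, QuotSMulTop c (X ⧸ Gam a X), inferInstance, inferInstance, inferInstance,
    ?_, ?_, ?_⟩
  · intro k hk
    exact dlt_quot (ha hca) hreg (dlt_of_surj hk _ (Gam a X).mkQ_surjective)
  · refine ((Gam a X).mkQ.annihilator_le_of_surjective (Gam a X).mkQ_surjective).trans ?_
    exact LinearMap.annihilator_le_of_surjective _ (Submodule.mkQ_surjective _)
  · intro i
    have hinj : Function.Injective (Gam a X).subtype := Subtype.val_injective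
    have hex : Function.Exact (Gam a X).subtype (Gam a X).mkQ :=
      LinearMap.exact_subtype_mkQ _
    have hsub : ∀ j, Subsingleton (D.M (j+1) (Gam a X)) := by
      intro j
      refine D.p4 j _ ?_
      rintro ⟨x, n, hn⟩
      exact ⟨n, fun r hr => Subtype.ext (hn r hr)⟩
    have hb : Function.Bijective (D.map (i+1) (Gam a X).mkQ) := by
      constructor
      · rw [← LinearMap.ker_eq_bot, LinearMap.ker_eq_bot']
        intro m hm
        obtain ⟨y, rfl⟩ := (D.exact' (i+1) hinj hex (Gam a X).mkQ_surjective m).1 hm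
        have := hsub i
        rw [Subsingleton.elim y 0, _root_.map_zero]
      · obtain ⟨δ, h1, h2⟩ := D.delta' (i+1) hinj hex (Gam a X).mkQ_surjective
        intro w
        have := hsub (i+1)
        exact (h1 w).1 (Subsingleton.elim _ _)
    let E := LinearEquiv.ofBijective _ hb
    let m : (X ⧸ Gam a X) →ₗ[S] (X ⧸ Gam a X) := c • LinearMap.id
    have hm : Function.Injective m := fun x y h => hreg h
    have hme : Function.Exact m (c • (⊤ : Submodule S (X ⧸ Gam a X))).mkQ := by
      intro y
      rw [Submodule.mkQ_apply, Submodule.Quotient.mk_eq_zero, Submodule.mem_smul_pointwise_iff_exists]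
      constructor
      · rintro ⟨b, _, hb⟩
        exact ⟨b, hb⟩
      · rintro ⟨b, hb⟩
        exact ⟨b, trivial, hb⟩
    obtain ⟨δ, h1, h2⟩ := D.delta' i hm hme (Submodule.mkQ_surjective _)
    refine ⟨E.symm.toLinearMap ∘ₗ δ, fun e => ?_⟩
    have h3 := h2 (E e)
    rw [D.map_smul_id] at h3
    have h4 : c • e = 0 ↔ c • E e = 0 := by
      rw [← _root_.map_smul, LinearEquiv.map_eq_zero_iff]
    rw [h4, h3]
    constructor
    · rintro ⟨b, hb⟩
      exact ⟨b, by simp [hb]⟩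
    · rintro ⟨b, hb⟩
      exact ⟨b, by simp [← hb]⟩

theorem ctor (i : ℕ) (X : Type u) [AddCommGroup X] [Module S X] {c : S} (hc : c ∈ a)
    (e : D.M i X) : ∃ n : ℕ, c ^ n • e = 0 := by
  obtain ⟨n, hn⟩ := D.tors i _ e
  exact ⟨n, hn _ (Ideal.pow_mem_pow hc n)⟩

theorem sub_of_inj (i : ℕ) (X : Type u) [AddCommGroup X] [Module S X] {c : S} (hc : c ∈ a)
    (h : ∀ e : D.M i X, c • e = 0 → e = 0) : Subsingleton (D.M i X) := by
  refine subsingleton_of_forall_eq 0 fun e => ?_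
  obtain ⟨n, hn⟩ := D.ctor i X hc e
  induction n with
  | zero => simpa using hn
  | succ n ih =>
    rw [pow_succ', mul_smul] at hn
    exact ih (h _ hn)

theorem Gr (ha : a ≤ maximalIdeal S) (k : ℕ) : ∀ (X : Type u) [AddCommGroup X] [Module S X]
    [Module.Finite S X], dlt S X k → ∀ n, k ≤ n → Subsingleton (D.M n X) := by
  induction k with
  | zero =>
    intro X _ _ _ h n _
    have := dlt_zero h
    exact D.sub_of_sub n X
  | succ k ih =>
    intro X _ _ _ h n hn
    obtain ⟨c, hca, Q, _, _, _, h1, _, h3⟩ := D.reduce ha X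
    obtain ⟨n, rfl⟩ : ∃ n', n = n' + 1 := ⟨n - 1, by omega⟩
    obtain ⟨δ, hδ⟩ := h3 n
    have := ih Q (h1 k h) n (by omega)
    refine D.sub_of_inj _ X hca fun e he => ?_
    obtain ⟨b, rfl⟩ := (hδ e).1 he
    rw [Subsingleton.elim b 0, _root_.map_zero]

theorem stepArt (i : ℕ) {X Q : Type u} [AddCommGroup X] [Module S X] [AddCommGroup Q] [Module S Q]
    [IsAdicComplete (maximalIdeal S) S]
    {c : S} (hca : c ∈ a) (δ : D.M i Q →ₗ[S] D.M (i+1) X)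
    (hδ : ∀ e, c • e = 0 ↔ e ∈ LinearMap.range δ) (hB : IsArtinian S (D.M i Q)) :
    IsArtinian S (D.M (i+1) X) ∧ ∀ q : Ideal S, q.IsPrime →
      Module.annihilator S (D.M (i+1) X) ≤ q → c ∈ q → Module.annihilator S (D.M i Q) ≤ q := by
  have hA : IsArtinian S (D.M (i+1) X) := by
    refine lemmaArt c (D.ctor (i+1) X hca) ?_
    have : LinearMap.ker (LinearMap.lsmul S (D.M (i+1) X) c) = LinearMap.range δ := by
      ext e; exact hδ e
    rw [this]
    infer_instance
  refine ⟨hA, fun q hq hle hcq y hy => ?_⟩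
  obtain ⟨r, hr⟩ := lemmaN (A := D.M (i+1) X) c y (by
    intro e he
    obtain ⟨b, rfl⟩ := (hδ e).1 he
    rw [← _root_.map_smul, Module.mem_annihilator.1 hy, _root_.map_zero])
  have : Module.annihilator S (D.M (i+1) X) ⊔ Ideal.span {c} ≤ q :=
    sup_le hle (by rw [Ideal.span_le]; simpa using hcq)
  exact hq.mem_of_pow_mem r (this hr)

variable [IsAdicComplete (maximalIdeal S) S]

theorem D1 (ha : a ≤ maximalIdeal S) (i : ℕ) : ∀ (X : Type u) [AddCommGroup X] [Module S X]
    [Module.Finite S X], dlt S X (i+1) → IsArtinian S (D.M i X) ∧ ∀ q : Ideal S, q.IsPrime →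
    Module.annihilator S (D.M i X) ≤ q → a ≤ q → q = maximalIdeal S := by
  induction i with
  | zero =>
    intro X _ _ _ h
    obtain ⟨j, hj, -⟩ := D.p0 X
    have hfin : Module.Finite S (D.M 0 X) := Module.Finite.of_injective j hj
    have h1 : dlt S (D.M 0 X) 1 := dlt_of_inj h j hj
    have h2 : ∀ q : Ideal S, q.IsPrime →
      Module.annihilator S (D.M 0 X) ≤ q → q = maximalIdeal S :=
      fun q hq hle => prime_eq_of_dlt_one h1 q hle
    exact ⟨artin_of_primes h2, fun q hq hle _ => h2 q hq hle⟩
  | succ i ih =>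
    intro X _ _ _ h
    obtain ⟨c, hca, Q, _, _, _, h1, _, h3⟩ := D.reduce ha X
    obtain ⟨δ, hδ⟩ := h3 i
    obtain ⟨i1, i2⟩ := ih Q (h1 _ h)
    obtain ⟨s1, s2⟩ := D.stepArt i hca δ hδ i1
    exact ⟨s1, fun q hq hle haq => i2 q hq (s2 q hq hle (haq hca)) haq⟩

theorem D2 (ha : a ≤ maximalIdeal S) (i : ℕ) : ∀ (X : Type u) [AddCommGroup X] [Module S X]
    [Module.Finite S X], (∀ q : Ideal S, q.IsPrime → Module.annihilator S X ≤ q → a ≤ q →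
      q = maximalIdeal S) →
    IsArtinian S (D.M i X) ∧ dlt S (S ⧸ Module.annihilator S (D.M i X)) (i+1) := by
  induction i with
  | zero =>
    intro X _ _ _ h
    obtain ⟨j, hj, -⟩ := D.p0 X
    have hfin : Module.Finite S (D.M 0 X) := Module.Finite.of_injective j hj
    have h2 : ∀ q : Ideal S, q.IsPrime →
        Module.annihilator S (D.M 0 X) ≤ q → q = maximalIdeal S := by
      intro q hq hle
      refine h q hq ((D.ann_le 0 X).trans hle) ?_
      intro r hr
      have hk : ∃ n : ℕ, r ^ n ∈ Module.annihilator S (D.M 0 X) := by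
        classical
        obtain ⟨G, hG⟩ := hfin.fg_top
        choose n hn using D.ctor 0 X hr
        refine ⟨G.sup n, ?_⟩
        rw [Module.mem_annihilator]
        intro e
        have he : e ∈ Submodule.span S (G : Set (D.M 0 X)) := hG ▸ trivial
        induction he using Submodule.span_induction with
        | mem g hg =>
          have := Finset.le_sup (f := n) hg
          obtain ⟨t, ht⟩ := Nat.exists_eq_add_of_le this
          rw [ht, add_comm, pow_add, mul_smul, hn, smul_zero]
        | zero => simp
        | add x y _ _ hx hy => rw [smul_add, hx, hy, add_zero]
        | smul b x _ hx => rw [smul_comm, hx, smul_zero]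
      obtain ⟨n, hn⟩ := hk
      exact hq.mem_of_pow_mem n (hle hn)
    refine ⟨artin_of_primes h2, dlt_one ?_⟩
    intro q hq hle
    rw [Ideal.annihilator_quotient] at hle
    exact h2 q hq hle
  | succ i ih =>
    intro X _ _ _ h
    obtain ⟨c, hca, Q, _, _, _, h1, h1', h3⟩ := D.reduce ha X
    obtain ⟨δ, hδ⟩ := h3 i
    obtain ⟨i1, i2⟩ := ih Q (fun q hq hle haq => h q hq (h1'.trans hle) haq)
    obtain ⟨s1, s2⟩ := D.stepArt i hca δ hδ i1
    refine ⟨s1, dlt_of_quot (ha hca) (lt_of_le_of_lt (supportDim_mono ?_) i2)⟩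
    intro p hp
    rw [Module.support_quotSMulTop] at hp
    obtain ⟨hp1, hp2⟩ := hp
    rw [Module.mem_support_iff_of_finite, Ideal.annihilator_quotient] at hp1 ⊢
    exact s2 p.1 p.2 hp1 (by simpa using hp2)

end LCD

end Part5

section Part6
open IsLocalRing CategoryTheory
open scoped Pointwise

theorem dlt_of_ann {S : Type u} [CommRing S] {X Y : Type u} [AddCommGroup X] [Module S X]
    [AddCommGroup Y] [Module S Y] [Module.Finite S X] [Module.Finite S Y] {k : ℕ}
    (h : dlt S X k) (hle : Module.annihilator S X ≤ Module.annihilator S Y) : dlt S Y k := by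
  refine lt_of_le_of_lt (supportDim_mono ?_) h
  intro p hp
  rw [Module.mem_support_iff_of_finite] at hp ⊢
  exact hle.trans hp

theorem exact_smul_mkQ {S : Type u} [CommRing S] {X : Type u} [AddCommGroup X] [Module S X] (c : S) :
    Function.Exact (c • (LinearMap.id : X →ₗ[S] X)) (c • (⊤ : Submodule S X)).mkQ := by
  intro y
  rw [Submodule.mkQ_apply, Submodule.Quotient.mk_eq_zero, Submodule.mem_smul_pointwise_iff_exists]
  constructor
  · rintro ⟨b, _, hb⟩
    exact ⟨b, hb⟩
  · rintro ⟨b, hb⟩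
    exact ⟨b, trivial, hb⟩

namespace LCD
variable {S : Type u} [CommRing S] {a : Ideal S} (D : LCD S a)
variable [IsNoetherianRing S] [IsLocalRing S] 

/-- the relevant set of primes -/
def Tg (a J : Ideal S) (d : ℕ) : Set (Ideal S) :=
  {p | p.IsPrime ∧ J ≤ p ∧ ¬ dlt S (S ⧸ p) d ∧
    ∀ q : Ideal S, q.IsPrime → p ≤ q → a ≤ q → q = maximalIdeal S}

theorem dlt_quot_mono {I J : Ideal S} (h : I ≤ J) {k : ℕ} (hI : dlt S (S ⧸ I) k) :
    dlt S (S ⧸ J) k :=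
  dlt_of_ann hI (by rw [Ideal.annihilator_quotient, Ideal.annihilator_quotient]; exact h)

theorem reg_of_notMem {q : Ideal S} (hq : q.IsPrime) {c : S} (hc : c ∉ q) :
    IsSMulRegular (S ⧸ q) c := by
  have h0 : (Ideal.Quotient.mk q c) ≠ 0 := by
    rwa [Ne, Ideal.Quotient.eq_zero_iff_mem]
  intro x y h
  simp only [Algebra.smul_def, Ideal.Quotient.algebraMap_eq] at h
  exact mul_left_cancel₀ h0 h

theorem Tg_min {J : Ideal S} {d : ℕ} (hJ : dlt S (S ⧸ J) (d+1)) {p q : Ideal S}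
    (hp : p ∈ Tg a J d) (hq : q.IsPrime) (hJq : J ≤ q) (hqp : q ≤ p) : q = p := by
  by_contra hne
  obtain ⟨c, hcp, hcq⟩ := SetLike.exists_of_lt (lt_of_le_of_ne hqp hne)
  have hcm : c ∈ maximalIdeal S := IsLocalRing.le_maximalIdeal hp.1.ne_top hcp
  have h1 := dlt_quot hcm (reg_of_notMem hq hcq) (dlt_quot_mono hJq hJ)
  refine hp.2.2.1 (lt_of_le_of_lt (supportDim_mono ?_) h1)
  intro r hr
  rw [Module.support_quotSMulTop]
  rw [Module.mem_support_iff_of_finite, Ideal.annihilator_quotient] at hr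
  refine ⟨?_, by simpa using hr hcp⟩
  rw [Module.mem_support_iff_of_finite, Ideal.annihilator_quotient]
  exact hqp.trans hr

theorem Tg_finite {J : Ideal S} {d : ℕ} (hJ : dlt S (S ⧸ J) (d+1)) : (Tg a J d).Finite := by
  refine (Ideal.finite_minimalPrimes_of_isNoetherianRing S J).subset fun p hp => ?_
  refine ⟨⟨hp.1, hp.2.1⟩, fun q hq hle => ?_⟩
  exact (Tg_min hJ hp hq.1 hq.2 hle).ge

theorem avoid {J I : Ideal S} {d : ℕ} (hJ : dlt S (S ⧸ J) (d+1)) (h : ∀ p ∈ Tg a J d, ¬ I ≤ p) :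
    ∃ s ∈ I, ∀ p ∈ Tg a J d, s ∉ p := by
  by_contra hcon
  push Not at hcon
  have h2 := (Ideal.subset_union_prime_finite (Tg_finite (a := a) hJ) (f := id) ⊥ ⊥
    (fun p hp _ _ => hp.1) (I := I)).1 (by
      intro s hs
      obtain ⟨p, hp, hsp⟩ := hcon s hs
      exact Set.mem_biUnion hp hsp)
  obtain ⟨p, hp, hle⟩ := h2
  exact h p hp hle

theorem surj_map (ha : a ≤ maximalIdeal S) {d : ℕ}
    {X Y : Type u} [AddCommGroup X] [Module S X] [Module.Finite S X] [AddCommGroup Y] [Module S Y]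
    (hX : dlt S X (d+1)) (f : X →ₗ[S] Y) (hf : Function.Surjective f) :
    Function.Surjective (D.map d f) := by
  obtain ⟨δ, h1, h2⟩ := D.delta' d (f := (LinearMap.ker f).subtype) (g := f)
    Subtype.val_injective (LinearMap.exact_subtype_ker_map f) hf
  have := D.Gr ha (d+1) (LinearMap.ker f)
    (dlt_of_inj hX (LinearMap.ker f).subtype Subtype.val_injective) (d+1) le_rfl
  intro y
  exact (h1 y).1 (Subsingleton.elim _ _)

variable [IsAdicComplete (maximalIdeal S) S]

theorem Vv (ha : a ≤ maximalIdeal S) {J : Ideal S} {d : ℕ} (hJ : dlt S (S ⧸ J) (d+1))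
    {q : Ideal S} (hq : q.IsPrime) (hJq : J ≤ q) (hqT : q ∉ Tg a J d) :
    Subsingleton (D.M d (S ⧸ q)) := by
  by_cases hd : dlt S (S ⧸ q) d
  · exact D.Gr ha d _ hd d le_rfl
  have h1 : ∃ q' : Ideal S, q'.IsPrime ∧ q ≤ q' ∧ a ≤ q' ∧ q' ≠ maximalIdeal S := by
    by_contra hcon
    push Not at hcon
    exact hqT ⟨hq, hJq, hd, hcon⟩
  obtain ⟨q', hq', hqq', haq', hne⟩ := h1
  by_contra hns
  have hdq := dlt_quot_mono hJq hJ
  refine hne ((D.D1 ha d (S ⧸ q) hdq).2 q' hq' (le_trans ?_ hqq') haq')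
  intro s hs
  by_contra hsq
  refine hns (subsingleton_of_forall_eq 0 fun e => ?_)
  have hs' := Module.mem_annihilator.1 hs
  by_cases hsm : s ∈ maximalIdeal S
  · have hreg := reg_of_notMem hq hsq
    have hQ := D.Gr ha d _ (dlt_quot hsm hreg hdq) d le_rfl
    have hex := D.exact' d (f := s • (LinearMap.id : (S ⧸ q) →ₗ[S] S ⧸ q)) (fun x y h => hreg h)
      (exact_smul_mkQ s) (Submodule.mkQ_surjective _)
    obtain ⟨b, rfl⟩ := (hex e).1 (Subsingleton.elim _ _)
    rw [D.map_smul_id, hs']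
  · have hu : IsUnit s := by simpa using hsm
    exact hu.smul_eq_zero.1 (hs' e)

theorem Zz (ha : a ≤ maximalIdeal S) {J : Ideal S} {d : ℕ} (hJ : dlt S (S ⧸ J) (d+1))
    (Y : Type u) [AddCommGroup Y] [Module S Y] [Module.Finite S Y]
    (hY : J ≤ Module.annihilator S Y) (hT : ∀ p ∈ Tg a J d, ¬ Module.annihilator S Y ≤ p) :
    Subsingleton (D.M d Y) := by
  revert hY hT
  refine IsNoetherianRing.induction_on_isQuotientEquivQuotientPrime S (M := Y) inferInstance
    (motive := fun Y _ _ _ => J ≤ Module.annihilator S Y →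
      (∀ p ∈ Tg a J d, ¬ Module.annihilator S Y ≤ p) → Subsingleton (D.M d Y)) ?_ ?_ ?_
  · intro N _ _ _ _ _ _
    exact D.sub_of_sub d N
  · intro N _ _ _ p e h1 h2
    rw [e.annihilator_eq, Ideal.annihilator_quotient] at h1 h2
    have := D.Vv ha hJ p.2 h1 (fun hp => h2 _ hp le_rfl)
    exact (D.equiv d e).toEquiv.subsingleton
  · intro N₁ _ _ _ N₂ _ _ _ N₃ _ _ _ f g hf hg hfg h1 h3 hh ht
    have a1 := f.annihilator_le_of_injective hf
    have a3 := g.annihilator_le_of_surjective hg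
    exact D.sub_mid d hf hfg hg (h1 (hh.trans a1) (fun p hp hle => ht p hp (a1.trans hle)))
      (h3 (hh.trans a3) (fun p hp hle => ht p hp (a3.trans hle)))

theorem Ww (ha : a ≤ maximalIdeal S) {J : Ideal S} {d : ℕ} (hJ : dlt S (S ⧸ J) (d+1))
    (X : Type u) [AddCommGroup X] [Module S X] [Module.Finite S X]
    (hX : J ≤ Module.annihilator S X) {s : S} (hs : ∀ p ∈ Tg a J d, s ∉ p) (e : D.M d X) :
    ∃ e' : D.M d X, s • e' = e := by
  let m : X →ₗ[S] X := s • LinearMap.id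
  have hdX : dlt S X (d+1) := dlt_of_ann hJ (by rwa [Ideal.annihilator_quotient])
  have h1 := D.surj_map ha hdX m.rangeRestrict m.surjective_rangeRestrict
  have h2 := D.exact' d (f := (LinearMap.range m).subtype) (g := (LinearMap.range m).mkQ)
    Subtype.val_injective (LinearMap.exact_subtype_mkQ _) (Submodule.mkQ_surjective _)
  have hann : Module.annihilator S X ≤ Module.annihilator S (X ⧸ LinearMap.range m) :=
    LinearMap.annihilator_le_of_surjective _ (Submodule.mkQ_surjective _)
  have h3 : Subsingleton (D.M d (X ⧸ LinearMap.range m)) := by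
    refine D.Zz ha hJ _ (hX.trans hann) fun p hp hle => hs p hp (hle ?_)
    rw [Module.mem_annihilator]
    intro w
    obtain ⟨x, rfl⟩ := Submodule.mkQ_surjective _ w
    rw [← _root_.map_smul]
    exact (Submodule.Quotient.mk_eq_zero _).2 ⟨x, rfl⟩
  obtain ⟨y, rfl⟩ := (h2 e).1 (Subsingleton.elim _ _)
  obtain ⟨z, rfl⟩ := h1 y
  refine ⟨z, ?_⟩
  rw [← D.map_comp, ← D.map_smul_id]
  rfl

theorem Kk (ha : a ≤ maximalIdeal S) {J : Ideal S} {d : ℕ} (hJ : dlt S (S ⧸ J) (d+1))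
    (Q : Type u) [AddCommGroup Q] [Module S Q] [Module.Finite S Q] :
    ∀ (N' N : Type u) [AddCommGroup N'] [Module S N'] [AddCommGroup N] [Module S N]
      [Module.Finite S N] (f : N' →ₗ[S] N) (g : N →ₗ[S] Q), Function.Injective f →
      Function.Exact f g → Function.Surjective g → J ≤ Module.annihilator S N →
      ∃ s, (∀ p ∈ Tg a J d, s ∉ p) ∧ ∀ e : D.M d N', D.map d f e = 0 → s • e = 0 := by
  refine IsNoetherianRing.induction_on_isQuotientEquivQuotientPrime S (M := Q) inferInstance
    (motive := fun Q _ _ _ => ∀ (N' N : Type u) [AddCommGroup N'] [Module S N'] [AddCommGroup N]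
      [Module S N] [Module.Finite S N] (f : N' →ₗ[S] N) (g : N →ₗ[S] Q), Function.Injective f →
      Function.Exact f g → Function.Surjective g → J ≤ Module.annihilator S N →
      ∃ s, (∀ p ∈ Tg a J d, s ∉ p) ∧ ∀ e : D.M d N', D.map d f e = 0 → s • e = 0) ?_ ?_ ?_
  · intro Q _ _ _ _ N' N _ _ _ _ _ f g hf hfg hg hJN
    have hsurj : Function.Surjective f := fun y => (hfg y).1 (Subsingleton.elim _ _)
    let E := LinearEquiv.ofBijective f ⟨hf, hsurj⟩
    refine ⟨1, fun p hp h => hp.1.ne_top ((Ideal.eq_top_iff_one _).2 h), fun e he => ?_⟩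
    have : D.equiv d E e = 0 := he
    rw [LinearEquiv.map_eq_zero_iff] at this
    rw [this, smul_zero]
  · intro Q _ _ _ q eq N' N _ _ _ _ _ f g hf hfg hg hJN
    have hQ : Module.annihilator S Q = q.1 := by
      rw [eq.annihilator_eq, Ideal.annihilator_quotient]
    have hJq : J ≤ q.1 := hQ ▸ hJN.trans (g.annihilator_le_of_surjective hg)
    by_cases hqT : q.1 ∈ Tg a J d
    · cases d with
      | zero =>
        refine ⟨1, fun p hp h => hp.1.ne_top ((Ideal.eq_top_iff_one _).2 h), fun e he => ?_⟩
        have : e = 0 := D.inj0 f hf (he.trans (_root_.map_zero _).symm)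
        rw [this, smul_zero]
      | succ d =>
        obtain ⟨δ, h1, h2⟩ := D.delta' d hf hfg hg
        have h3 := (D.D2 ha d Q (fun r hr hle har => hqT.2.2.2 r hr (hQ ▸ hle) har)).2
        obtain ⟨s, hs, hs'⟩ := avoid (a := a) (I := Module.annihilator S (D.M d Q)) hJ
          (fun p hp hle => hp.2.2.1 (dlt_quot_mono hle h3))
        refine ⟨s, hs', fun e he => ?_⟩
        obtain ⟨b, rfl⟩ := (h2 e).1 he
        rw [← _root_.map_smul, Module.mem_annihilator.1 hs, _root_.map_zero]
    · obtain ⟨s, hs, hs'⟩ := avoid (a := a) (I := q.1) hJ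
        (fun p hp hle => hqT ((Tg_min hJ hp q.2 hJq hle) ▸ hp))
      refine ⟨s, hs', fun e he => ?_⟩
      have hr : ∀ x : N, s • x ∈ LinearMap.range f := by
        intro x
        refine (hfg _).1 ?_
        rw [_root_.map_smul]
        exact Module.mem_annihilator.1 (hQ ▸ hs) _
      let h : N →ₗ[S] N' := (LinearEquiv.ofInjective f hf).symm.toLinearMap ∘ₗ
        (s • (LinearMap.id : N →ₗ[S] N)).codRestrict (LinearMap.range f) hr
      have hh : h ∘ₗ f = s • LinearMap.id := by
        ext x
        apply hf
        have : ∀ y, f ((LinearEquiv.ofInjective f hf).symm y) = y := by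
          intro y
          have := (LinearEquiv.ofInjective f hf).apply_symm_apply y
          exact congrArg Subtype.val this
        simp [h, this]
      rw [← D.map_smul_id, ← hh, D.map_comp, he, _root_.map_zero]
  · intro Q₁ _ _ _ Q₂ _ _ _ Q₃ _ _ _ u v hu hv huv h1 h3 N' N _ _ _ _ _ f g hf hfg hg hJN
    let N1 := LinearMap.ker (v ∘ₗ g)
    have hg1 : ∀ x : N1, g x.1 ∈ LinearMap.range u := fun x => (huv _).1 x.2
    let E := LinearEquiv.ofInjective u hu
    have hE : ∀ y, u (E.symm y) = y := fun y => congrArg Subtype.val (E.apply_symm_apply y)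
    let g1 : N1 →ₗ[S] Q₁ := E.symm.toLinearMap ∘ₗ
      (g ∘ₗ N1.subtype).codRestrict (LinearMap.range u) hg1
    have hg1' : ∀ x : N1, u (g1 x) = g x.1 := fun x => hE _
    let f1 : N' →ₗ[S] N1 := f.codRestrict N1 (fun x => by
      change v (g (f x)) = 0
      rw [hfg.apply_apply_eq_zero, _root_.map_zero])
    obtain ⟨s1, hs1, hs1'⟩ := h1 N' N1 f1 g1 (fun x y h => hf (congrArg Subtype.val h))
      (by
        intro x
        have : g1 x = 0 ↔ g x.1 = 0 := by
          rw [← hg1', map_eq_zero_iff u hu]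
        rw [this, hfg]
        constructor
        · rintro ⟨y, hy⟩
          exact ⟨y, Subtype.ext hy⟩
        · rintro ⟨y, hy⟩
          exact ⟨y, congrArg Subtype.val hy⟩)
      (by
        intro w
        obtain ⟨x, hx⟩ := hg (u w)
        refine ⟨⟨x, ?_⟩, hu ?_⟩
        · change v (g x) = 0
          rw [hx, huv.apply_apply_eq_zero]
        · rw [hg1', hx])
      (hJN.trans (N1.subtype.annihilator_le_of_injective Subtype.val_injective))
    obtain ⟨s3, hs3, hs3'⟩ := h3 N1 N N1.subtype (v ∘ₗ g) Subtype.val_injective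
      (LinearMap.exact_subtype_ker_map _) (hv.comp hg) hJN
    refine ⟨s1 * s3, fun p hp h => (hp.1.mem_or_mem h).elim (hs1 p hp) (hs3 p hp), fun e he => ?_⟩
    rw [mul_smul]
    apply hs1'
    rw [_root_.map_smul]
    apply hs3'
    rw [← D.map_comp]
    exact he

theorem complete_case (ha : a ≤ maximalIdeal S) {d : ℕ} {X N : Type u} [AddCommGroup X]
    [Module S X] [Module.Finite S X] [AddCommGroup N] [Module S N] (hX : dlt S X (d+1))
    (f : N →ₗ[S] X) (hf : Function.Injective f) (h0 : ∀ e, D.map d f e = 0) :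
    Subsingleton (D.M d N) := by
  have hJ : dlt S (S ⧸ Module.annihilator S X) (d+1) :=
    dlt_of_ann hX (by rw [Ideal.annihilator_quotient])
  have hN : Module.Finite S N := Module.Finite.of_injective f hf
  obtain ⟨s, hs, hs'⟩ := D.Kk ha hJ (X ⧸ LinearMap.range f) N X f (LinearMap.range f).mkQ hf
    (LinearMap.exact_map_mkQ_range f) (Submodule.mkQ_surjective _) le_rfl
  refine subsingleton_of_forall_eq 0 fun e => ?_
  obtain ⟨e', rfl⟩ := D.Ww ha hJ N (f.annihilator_le_of_injective hf) hs e
  exact hs' e' (h0 e')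

end LCD

end Part6

section Part7
open IsLocalRing CategoryTheory

section HE
open Abelian
variable {R : Type u} [CommRing R] (a : Ideal R)

/-- `R ⧸ a ^ n` -/
abbrev Zq (n : ℕ) : ModuleCat.{u} R := ModuleCat.of R (R ⧸ a ^ n)

/-- transition maps -/
def tr {n m : ℕ} (h : n ≤ m) : Zq a m ⟶ Zq a n :=
  ModuleCat.ofHom (Submodule.mapQ (a ^ m) (a ^ n) LinearMap.id (Ideal.pow_le_pow_right h))

theorem tr_self (n : ℕ) : tr a (le_refl n) = 𝟙 _ := by
  ext x
  rfl

theorem tr_comp {n m k : ℕ} (h : n ≤ m) (h' : m ≤ k) :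
    tr a h' ≫ tr a h = tr a (h.trans h') := by
  ext x
  rfl

/-- transition maps on `Ext` -/
noncomputable def trE (i : ℕ) (X : ModuleCat.{u} R) (n m : ℕ) (h : n ≤ m) :
    Ext.{u} (Zq a n) X i →ₗ[R] Ext.{u} (Zq a m) X i :=
  Ext.precompOfLinear (Ext.mk₀ (tr a h)) R X (zero_add i)

theorem trE_apply {i : ℕ} {X : ModuleCat.{u} R} {n m : ℕ} (h : n ≤ m) (e : Ext.{u} (Zq a n) X i) :
    trE a i X n m h e = (Ext.mk₀ (tr a h)).comp e (zero_add i) := rfl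

instance (i : ℕ) (X : ModuleCat.{u} R) :
    DirectedSystem (fun n => Ext.{u} (Zq a n) X i) (fun n m h => trE a i X n m h) where
  map_self := by
    intro n e
    rw [trE_apply, tr_self, Ext.mk₀_id_comp]
  map_map := by
    intro k j n h1 h2 e
    rw [trE_apply, trE_apply, trE_apply, Ext.mk₀_comp_mk₀_assoc, tr_comp]

/-- local cohomology as direct limit of `Ext` -/
abbrev HE (i : ℕ) (X : ModuleCat.{u} R) : Type u :=
  Module.DirectLimit (fun n => Ext.{u} (Zq a n) X i) (trE a i X)

/-- canonical map -/
noncomputable def HE.of (i : ℕ) (X : ModuleCat.{u} R) (n : ℕ) :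
    Ext.{u} (Zq a n) X i →ₗ[R] HE a i X :=
  Module.DirectLimit.of R ℕ (fun n => Ext.{u} (Zq a n) X i) (trE a i X) n

theorem HE.of_tr {i : ℕ} {X : ModuleCat.{u} R} {n m : ℕ} (h : n ≤ m) (e : Ext.{u} (Zq a n) X i) :
    HE.of a i X m ((Ext.mk₀ (tr a h)).comp e (zero_add i)) = HE.of a i X n e :=
  Module.DirectLimit.of_f

theorem HE.exists_of {i : ℕ} {X : ModuleCat.{u} R} (z : HE a i X) : ∃ n e, HE.of a i X n e = z :=
  Module.DirectLimit.exists_of z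

theorem HE.exists_of_ge {i : ℕ} {X : ModuleCat.{u} R} (z : HE a i X) (k : ℕ) :
    ∃ n e, k ≤ n ∧ HE.of a i X n e = z := by
  obtain ⟨n, e, rfl⟩ := HE.exists_of a z
  exact ⟨max n k, _, le_max_right _ _, HE.of_tr a (le_max_left n k) e⟩

theorem HE.zero_exact {i : ℕ} {X : ModuleCat.{u} R} {n : ℕ} {e : Ext.{u} (Zq a n) X i}
    (h : HE.of a i X n e = 0) : ∃ m, ∃ h : n ≤ m, (Ext.mk₀ (tr a h)).comp e (zero_add i) = 0 :=
  Module.DirectLimit.of.zero_exact h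

/-- postcomposition -/
noncomputable def HE.post {X Y : ModuleCat.{u} R} {k : ℕ} (β : Ext.{u} X Y k) {i j : ℕ}
    (h : i + k = j) : HE a i X →ₗ[R] HE a j Y :=
  Module.DirectLimit.map (fun n => Ext.postcompOfLinear β R (Zq a n) h) (by
    intro n m hnm
    ext e
    change ((Ext.mk₀ (tr a hnm)).comp e (zero_add i)).comp β h =
      (Ext.mk₀ (tr a hnm)).comp (e.comp β h) (zero_add j)
    exact Ext.comp_assoc _ _ _ _ _ (by lia))

@[simp]
theorem HE.post_of {X Y : ModuleCat.{u} R} {k : ℕ} (β : Ext.{u} X Y k) {i j : ℕ}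
    (h : i + k = j) (n : ℕ) (e : Ext.{u} (Zq a n) X i) :
    HE.post a β h (HE.of a i X n e) = HE.of a j Y n (e.comp β h) :=
  Module.DirectLimit.map_apply_of _ _ _

theorem HE.exact {X Y Z : ModuleCat.{u} R} {k l : ℕ} (β : Ext.{u} X Y k) (γ : Ext.{u} Y Z l)
    {i j m : ℕ} (h : i + k = j) (h' : j + l = m)
    (hz : ∀ n (e : Ext.{u} (Zq a n) X i), (e.comp β h).comp γ h' = 0)
    (hex : ∀ n (e : Ext.{u} (Zq a n) Y j), e.comp γ h' = 0 →
      ∃ e' : Ext.{u} (Zq a n) X i, e'.comp β h = e) :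
    Function.Exact (HE.post a β h) (HE.post a γ h') := by
  intro y
  constructor
  · obtain ⟨n, e, rfl⟩ := HE.exists_of a y
    intro h0
    rw [HE.post_of] at h0
    obtain ⟨t, hnt, ht⟩ := HE.zero_exact a h0
    rw [← Ext.comp_assoc _ _ _ (zero_add j) h' (by lia)] at ht
    obtain ⟨e', he'⟩ := hex t _ ht
    refine ⟨HE.of a i X t e', ?_⟩
    rw [HE.post_of, he', HE.of_tr]
  · rintro ⟨x, rfl⟩
    obtain ⟨n, e, rfl⟩ := HE.exists_of a x
    rw [HE.post_of, HE.post_of, hz, _root_.map_zero]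

/-- the functor -/
noncomputable def HE.functor (i : ℕ) : ModuleCat.{u} R ⥤ ModuleCat.{u} R where
  obj X := ModuleCat.of R (HE a i X)
  map f := ModuleCat.ofHom (HE.post a (Ext.mk₀ f) (add_zero i))
  map_id X := by
    refine ModuleCat.hom_ext (LinearMap.ext fun z => ?_)
    obtain ⟨n, e, rfl⟩ := HE.exists_of a z
    simp
  map_comp f g := by
    refine ModuleCat.hom_ext (LinearMap.ext fun z => ?_)
    obtain ⟨n, e, rfl⟩ := HE.exists_of a z
    simp [← Ext.mk₀_comp_mk₀, Ext.comp_assoc_of_third_deg_zero]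

theorem HE.functor_map {i : ℕ} {X Y : ModuleCat.{u} R} (f : X ⟶ Y) (z : HE a i X) :
    (HE.functor a i).map f z = HE.post a (Ext.mk₀ f) (add_zero i) z := rfl

/-- a short exact sequence in `ModuleCat` -/
theorem ses {X Y Z : Type u} [AddCommGroup X] [AddCommGroup Y] [AddCommGroup Z]
    [Module R X] [Module R Y] [Module R Z] (f : X →ₗ[R] Y) (g : Y →ₗ[R] Z)
    (hf : Function.Injective f) (hfg : Function.Exact f g) (hg : Function.Surjective g) :
    (ShortComplex.mk (ModuleCat.ofHom f) (ModuleCat.ofHom g) (by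
      ext x; exact hfg.apply_apply_eq_zero x)).ShortExact where
  exact := by
    rw [ShortComplex.ShortExact.moduleCat_exact_iff_function_exact]
    exact hfg
  mono_f := (ModuleCat.mono_iff_injective _).2 hf
  epi_g := (ModuleCat.epi_iff_surjective _).2 hg

end HE

end Part7

section Part8
open IsLocalRing CategoryTheory

section
variable {R : Type u} [CommRing R] (a : Ideal R)

theorem exists_pow_kill {Y : Type u} [AddCommGroup Y] [Module R Y] [hfin : Module.Finite R Y]
    (h : ∀ y : Y, ∃ n : ℕ, ∀ r ∈ a ^ n, r • y = 0) : ∃ t : ℕ, ∀ r ∈ a ^ t, ∀ y : Y, r • y = 0 := by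
  classical
  obtain ⟨G, hG⟩ := hfin.fg_top
  choose n hn using h
  refine ⟨G.sup n, fun r hr y => ?_⟩
  have he : y ∈ Submodule.span R (G : Set Y) := hG ▸ trivial
  induction he using Submodule.span_induction with
  | mem g hg => exact hn g r (Ideal.pow_le_pow_right (Finset.le_sup (f := n) hg) hr)
  | zero => simp
  | add x y _ _ hx hy => rw [smul_add, hx, hy, add_zero]
  | smul b x _ hx => rw [smul_comm, hx, smul_zero]

theorem Gam_injective [IsNoetherianRing R] (I : Type u) [AddCommGroup I] [Module R I]
    [hI : Module.Injective R I] : Module.Injective R (LCD.Gam a I) := by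
  apply Module.Baer.injective
  intro b f
  obtain ⟨t, ht⟩ := exists_pow_kill a (Y := LinearMap.range f) (by
    rintro ⟨⟨y, n, hn⟩, hy⟩
    exact ⟨n, fun r hr => Subtype.ext (Subtype.ext (hn r hr))⟩)
  obtain ⟨k, hk⟩ := Ideal.exists_pow_inf_eq_pow_smul a (M := R) b
  let K : Submodule R b := Submodule.comap b.subtype (a ^ (k + t))
  have hK : K ≤ LinearMap.ker f := by
    intro x hx
    have h1 : (x : R) ∈ a ^ (k + t) • (⊤ : Submodule R R) ⊓ b := ⟨by
      rw [smul_eq_mul, Ideal.mul_top]; exact hx, x.2⟩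
    rw [hk (k + t) (by omega), Nat.add_sub_cancel_left] at h1
    have h2 : a ^ t • (a ^ k • (⊤ : Submodule R R) ⊓ b) ≤
        Submodule.map b.subtype (LinearMap.ker f) := by
      rw [Submodule.smul_le]
      rintro r hr y ⟨-, hy⟩
      refine ⟨r • ⟨y, hy⟩, ?_, rfl⟩
      rw [SetLike.mem_coe, LinearMap.mem_ker, map_smul]
      exact congrArg Subtype.val (ht r hr ⟨f ⟨y, hy⟩, ⟨_, rfl⟩⟩)
    obtain ⟨y, hy, hyx⟩ := h2 h1
    rwa [← Subtype.ext hyx]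
  let g : (b ⧸ K) →ₗ[R] (R ⧸ a ^ (k + t)) := Submodule.mapQ K (a ^ (k + t)) b.subtype le_rfl
  have hg : Function.Injective g := by
    rw [← LinearMap.ker_eq_bot, LinearMap.ker_eq_bot']
    intro w hw
    obtain ⟨x, rfl⟩ := K.mkQ_surjective w
    exact (Submodule.Quotient.mk_eq_zero K).2
      (show (x : R) ∈ a ^ (k + t) from (Submodule.Quotient.mk_eq_zero (a ^ (k + t))).1 hw)
  obtain ⟨h, hh⟩ := hI.out g hg ((LCD.Gam a I).subtype ∘ₗ K.liftQ f hK)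
  refine ⟨(h ∘ₗ (a ^ (k + t)).mkQ).codRestrict (LCD.Gam a I) ?_, ?_⟩
  · intro x
    refine ⟨k + t, fun r hr => ?_⟩
    rw [LinearMap.comp_apply, ← map_smul, ← map_smul]
    have : (a ^ (k + t)).mkQ (r • x) = 0 :=
      (Submodule.Quotient.mk_eq_zero _).2 (Ideal.mul_mem_right _ _ hr)
    rw [this, map_zero]
  · intro x hx
    exact Subtype.ext (hh (K.mkQ ⟨x, hx⟩))
end

section HE
open Abelian
variable {R : Type u} [CommRing R] (a : Ideal R)

theorem HE.surj0 {Y Z : Type u} [AddCommGroup Y] [AddCommGroup Z] [Module R Y] [Module R Z]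
    (g : Y →ₗ[R] Z) (hg : Function.Surjective g)
    (hY : ∀ y : Y, ∃ n : ℕ, ∀ r ∈ a ^ n, r • y = 0) :
    Function.Surjective (HE.post a (Ext.mk₀ (ModuleCat.ofHom g)) (add_zero 0)) := by
  intro z
  obtain ⟨n, e, rfl⟩ := HE.exists_of a z
  obtain ⟨φ, rfl⟩ := (Ext.mk₀_bijective _ _).2 e
  obtain ⟨y, hy⟩ := hg (φ.hom (Submodule.Quotient.mk (1 : R)))
  obtain ⟨m, hm⟩ := hY y
  let ψ : Zq a (n + m) ⟶ ModuleCat.of R Y := ModuleCat.ofHom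
    (Submodule.liftQ (a ^ (n + m)) (LinearMap.toSpanSingleton R Y y) (by
      intro r hr
      exact hm r (Ideal.pow_le_pow_right (by omega) hr)))
  refine ⟨HE.of a 0 _ (n + m) (Ext.mk₀ ψ), ?_⟩
  rw [HE.post_of, Ext.mk₀_comp_mk₀, ← HE.of_tr a (show n ≤ n + m by omega), Ext.mk₀_comp_mk₀]
  congr 2
  refine ModuleCat.hom_ext (Submodule.linearMap_qext _ (LinearMap.ext_ring ?_))
  change g ((1 : R) • y) = φ.hom (Submodule.Quotient.mk (1 : R))
  rw [one_smul, hy]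

theorem HE.p4 [IsNoetherianRing R] (i : ℕ) : ∀ (X : Type u) [AddCommGroup X] [Module R X],
    (∀ x : X, ∃ n : ℕ, ∀ r ∈ a ^ n, r • x = 0) →
    Subsingleton (HE a (i+1) (ModuleCat.of R X)) := by
  have key : ∀ (X : Type u) [AddCommGroup X] [Module R X],
      (∀ x : X, ∃ n : ℕ, ∀ r ∈ a ^ n, r • x = 0) → ∃ (E : Type u) (_ : AddCommGroup E)
      (_ : Module R E) (f : X →ₗ[R] E), Function.Injective f ∧ Injective (ModuleCat.of R E) ∧
      (∀ x : E, ∃ n : ℕ, ∀ r ∈ a ^ n, r • x = 0) := by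
    intro X _ _ hX
    obtain ⟨I, _, _, f, hI, hf⟩ := exists_injective_embedding (S := R) X
    have := Gam_injective a I
    refine ⟨LCD.Gam a I, inferInstance, inferInstance, f.codRestrict (LCD.Gam a I) ?_, ?_,
      Module.injective_object_of_injective_module R _, ?_⟩
    · intro x
      obtain ⟨n, hn⟩ := hX x
      exact ⟨n, fun r hr => by rw [← map_smul, hn r hr, map_zero]⟩
    · intro x y h
      exact hf (congrArg Subtype.val h)
    · rintro ⟨x, n, hn⟩
      exact ⟨n, fun r hr => Subtype.ext (hn r hr)⟩
  induction i with
  | zero =>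
    intro X _ _ hX
    obtain ⟨E, _, _, f, hf, hE, hE'⟩ := key X hX
    have hS := ses f (LinearMap.range f).mkQ hf (LinearMap.exact_map_mkQ_range f)
      (Submodule.mkQ_surjective _)
    refine subsingleton_of_forall_eq 0 fun z => ?_
    obtain ⟨n, e, rfl⟩ := HE.exists_of a z
    obtain ⟨e', rfl⟩ := Ext.covariant_sequence_exact₁ _ hS e (Ext.eq_zero_of_injective _)
      (zero_add 1)
    rw [← HE.post_of]
    obtain ⟨w, hw⟩ := HE.surj0 a (LinearMap.range f).mkQ (Submodule.mkQ_surjective _) hE'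
      (HE.of a 0 _ n e')
    erw [← hw]
    obtain ⟨m, w, rfl⟩ := HE.exists_of a w
    rw [HE.post_of, HE.post_of, Ext.comp_assoc_of_second_deg_zero]
    erw [hS.comp_extClass, Ext.comp_zero, map_zero]
  | succ i ih =>
    intro X _ _ hX
    obtain ⟨E, _, _, f, hf, hE, hE'⟩ := key X hX
    have hS := ses f (LinearMap.range f).mkQ hf (LinearMap.exact_map_mkQ_range f)
      (Submodule.mkQ_surjective _)
    refine subsingleton_of_forall_eq 0 fun z => ?_
    obtain ⟨n, e, rfl⟩ := HE.exists_of a z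
    obtain ⟨e', rfl⟩ := Ext.covariant_sequence_exact₁ _ hS e (Ext.eq_zero_of_injective _)
      rfl
    rw [← HE.post_of]
    have := ih (E ⧸ LinearMap.range f) (by
      intro w
      obtain ⟨y, rfl⟩ := Submodule.mkQ_surjective _ w
      obtain ⟨n, hn⟩ := hE' y
      exact ⟨n, fun r hr => by rw [← map_smul, hn r hr, map_zero]⟩)
    have h0 : HE.of a (i+1) _ n e' = 0 := this.elim _ _
    erw [h0, map_zero]

theorem HE.smul_zero' {i n : ℕ} {X : ModuleCat.{u} R} (e : Ext.{u} (Zq a n) X i) {r : R}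
    (hr : r ∈ a ^ n) : r • e = 0 := by
  have h0 : r • 𝟙 (Zq a n) = 0 := by
    refine ModuleCat.hom_ext (LinearMap.ext fun w => ?_)
    obtain ⟨y, rfl⟩ := Submodule.mkQ_surjective _ w
    change r • (a ^ n).mkQ y = 0
    rw [← map_smul]
    exact (Submodule.Quotient.mk_eq_zero _).2 (Ideal.mul_mem_right _ _ hr)
  rw [← Ext.mk₀_id_comp (r • e), Ext.comp_smul, ← Ext.smul_comp, ← Ext.mk₀_smul, h0,
    Ext.mk₀_zero, Ext.zero_comp]

theorem HE.inj0 {X Y : Type u} [AddCommGroup X] [AddCommGroup Y] [Module R X] [Module R Y]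
    (f : X →ₗ[R] Y) (hf : Function.Injective f) :
    Function.Injective (HE.post a (Ext.mk₀ (ModuleCat.ofHom f)) (add_zero 0)) := by
  have hm : Mono (ModuleCat.ofHom f) := (ModuleCat.mono_iff_injective _).2 hf
  refine (injective_iff_map_eq_zero _).2 fun z hz => ?_
  obtain ⟨n, e, rfl⟩ := HE.exists_of a z
  rw [HE.post_of] at hz
  obtain ⟨m, hnm, hm⟩ := HE.zero_exact a hz
  obtain ⟨φ, rfl⟩ := (Ext.mk₀_bijective _ _).2 e
  rw [Ext.mk₀_comp_mk₀, Ext.mk₀_comp_mk₀, Ext.mk₀_eq_zero_iff, ← Category.assoc] at hm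
  have h0 : tr a hnm ≫ φ = 0 := by
    rw [← cancel_mono (ModuleCat.ofHom f), hm, Limits.zero_comp]
  rw [← HE.of_tr a hnm, Ext.mk₀_comp_mk₀, h0, Ext.mk₀_zero, map_zero]

/-- evaluation at one -/
noncomputable def HE.ev (X : Type u) [AddCommGroup X] [Module R X] (n : ℕ) :
    Ext.{u} (Zq a n) (ModuleCat.of R X) 0 →ₗ[R] X :=
  { toFun := fun e => (Ext.linearEquiv₀ (R := R) e).hom (Submodule.Quotient.mk (1 : R))
    map_add' := by intro x y; rw [map_add]; rfl
    map_smul' := by intro r x; rw [map_smul]; rfl }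

theorem HE.ev_mk (X : Type u) [AddCommGroup X] [Module R X] (n : ℕ)
    (φ : Zq a n ⟶ ModuleCat.of R X) :
    HE.ev a X n (Ext.mk₀ φ) = φ.hom (Submodule.Quotient.mk (1 : R)) := by
  have : Ext.linearEquiv₀ (R := R) (Ext.mk₀ φ) = φ :=
    (Ext.linearEquiv₀ (R := R)).apply_symm_apply φ
  change (Ext.linearEquiv₀ (R := R) (Ext.mk₀ φ)).hom _ = _
  rw [this]

theorem HE.p0 (X : Type u) [AddCommGroup X] [Module R X] :
    ∃ j : HE a 0 (ModuleCat.of R X) →ₗ[R] X, Function.Injective j ∧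
      ∀ (α : X →ₗ[R] X) e,
        j (HE.post a (Ext.mk₀ (ModuleCat.ofHom α)) (add_zero 0) e) = α (j e) := by
  have hg : ∀ n m (hnm : n ≤ m) x, HE.ev a X m (trE a 0 _ n m hnm x) = HE.ev a X n x := by
    intro n m hnm x
    obtain ⟨φ, rfl⟩ := (Ext.mk₀_bijective _ _).2 x
    rw [trE_apply, Ext.mk₀_comp_mk₀, HE.ev_mk, HE.ev_mk]
    rfl
  refine ⟨Module.DirectLimit.lift R ℕ _ _ (HE.ev a X) hg,
    Module.DirectLimit.lift_injective _ _ ?_, ?_⟩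
  swap
  · intro α z
    obtain ⟨n, e, rfl⟩ := HE.exists_of a z
    obtain ⟨φ, rfl⟩ := (Ext.mk₀_bijective _ _).2 e
    have hl : ∀ e, Module.DirectLimit.lift R ℕ _ _ (HE.ev a X) hg (HE.of a 0 _ n e) =
        HE.ev a X n e := fun e => Module.DirectLimit.lift_of _ _ _
    rw [HE.post_of, hl, hl, Ext.mk₀_comp_mk₀, HE.ev_mk, HE.ev_mk]
    rfl
  intro n
  refine (injective_iff_map_eq_zero (HE.ev a X n)).2 fun e he => ?_
  obtain ⟨φ, rfl⟩ := (Ext.mk₀_bijective _ _).2 e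
  rw [HE.ev_mk] at he
  have : φ = 0 := ModuleCat.hom_ext (Submodule.linearMap_qext _ (LinearMap.ext_ring he))
  rw [this, Ext.mk₀_zero]

section
variable {X Y Z : Type u} [AddCommGroup X] [AddCommGroup Y] [AddCommGroup Z]
    [Module R X] [Module R Y] [Module R Z] (f : X →ₗ[R] Y) (g : Y →ₗ[R] Z)

theorem HE.exact2 (i : ℕ) (hf : Function.Injective f) (hfg : Function.Exact f g)
    (hg : Function.Surjective g) :
    Function.Exact (HE.post a (Ext.mk₀ (ModuleCat.ofHom f)) (add_zero i))
      (HE.post a (Ext.mk₀ (ModuleCat.ofHom g)) (add_zero i)) := by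
  have hS := ses f g hf hfg hg
  refine HE.exact a _ _ (add_zero i) (add_zero i) ?_ ?_
  · intro n e
    rw [Ext.comp_assoc_of_second_deg_zero, Ext.mk₀_comp_mk₀]
    have h0 : ModuleCat.ofHom f ≫ ModuleCat.ofHom g = 0 :=
      ModuleCat.hom_ext (LinearMap.ext fun x => hfg.apply_apply_eq_zero x)
    rw [h0, Ext.mk₀_zero, Ext.comp_zero]
  · intro n e he
    exact Ext.covariant_sequence_exact₂ _ hS e he

theorem HE.exact3 (i : ℕ) (hf : Function.Injective f) (hfg : Function.Exact f g)
    (hg : Function.Surjective g) :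
    Function.Exact (HE.post a (Ext.mk₀ (ModuleCat.ofHom g)) (add_zero i))
      (HE.post a (ses f g hf hfg hg).extClass rfl : _ →ₗ[R] HE a (i+1) (ModuleCat.of R X)) := by
  have hS := ses f g hf hfg hg
  refine HE.exact a _ _ (add_zero i) rfl ?_ ?_
  · intro n e
    rw [Ext.comp_assoc_of_second_deg_zero]
    have := hS.comp_extClass
    dsimp only at this
    rw [this, Ext.comp_zero]
  · intro n e he
    exact Ext.covariant_sequence_exact₃ _ hS e rfl he

theorem HE.exact1 (i : ℕ) (hf : Function.Injective f) (hfg : Function.Exact f g)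
    (hg : Function.Surjective g) :
    Function.Exact 
      (HE.post a (ses f g hf hfg hg).extClass rfl : _ →ₗ[R] HE a (i+1) (ModuleCat.of R X))
      (HE.post a (Ext.mk₀ (ModuleCat.ofHom f)) (add_zero (i+1))) := by
  have hS := ses f g hf hfg hg
  refine HE.exact a _ _ rfl (add_zero (i+1)) ?_ ?_
  · intro n e
    rw [Ext.comp_assoc_of_third_deg_zero]
    have := hS.extClass_comp
    dsimp only at this
    rw [this, Ext.comp_zero]
  · intro n e he
    exact Ext.covariant_sequence_exact₁ _ hS e he rfl

theorem HE.extnat (i : ℕ) (hf : Function.Injective f) (hfg : Function.Exact f g)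
    (hg : Function.Surjective g) (α : X →ₗ[R] X) (β : Y →ₗ[R] Y) (γ : Z →ₗ[R] Z)
    (h1 : f ∘ₗ α = β ∘ₗ f) (h2 : g ∘ₗ β = γ ∘ₗ g) (z : HE a i (ModuleCat.of R Z)) :
    HE.post a (ses f g hf hfg hg).extClass (rfl : i + 1 = i + 1)
      (HE.post a (Ext.mk₀ (ModuleCat.ofHom γ)) (add_zero i) z) =
    HE.post a (Ext.mk₀ (ModuleCat.ofHom α)) (add_zero (i+1))
      (HE.post a (ses f g hf hfg hg).extClass (rfl : i + 1 = i + 1) z) := by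
  have hS := ses f g hf hfg hg
  obtain ⟨n, e, rfl⟩ := HE.exists_of a z
  rw [HE.post_of, HE.post_of, HE.post_of, HE.post_of, Ext.comp_assoc_of_second_deg_zero,
    Ext.comp_assoc_of_third_deg_zero]
  have := hS.extClass_naturality hS
    { τ₁ := ModuleCat.ofHom α
      τ₂ := ModuleCat.ofHom β
      τ₃ := ModuleCat.ofHom γ
      comm₁₂ := ModuleCat.hom_ext h1
      comm₂₃ := ModuleCat.hom_ext h2 }
  dsimp only at this
  rw [this]
end

/-- the local cohomology data -/
noncomputable def lcR [IsNoetherianRing R] : LCD R a where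
  H := HE.functor a
  map_smul i X Y s f := by
    refine ModuleCat.hom_ext (LinearMap.ext fun z => ?_)
    obtain ⟨n, e, rfl⟩ := HE.exists_of a z
    change HE.post a _ _ _ = s • HE.post a _ _ _
    rw [HE.post_of, HE.post_of, Ext.mk₀_smul, Ext.comp_smul, map_smul]
  map_add i X Y f g := by
    refine ModuleCat.hom_ext (LinearMap.ext fun z => ?_)
    obtain ⟨n, e, rfl⟩ := HE.exists_of a z
    change HE.post a _ _ _ = HE.post a _ _ _ + HE.post a _ _ _
    rw [HE.post_of, HE.post_of, HE.post_of, Ext.mk₀_add, Ext.comp_add, map_add]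
  exact i X Y Z _ _ _ _ _ _ f g hf hfg hg := HE.exact2 a f g i hf hfg hg
  delta i X Y Z _ _ _ _ _ _ f g hf hfg hg :=
    ⟨HE.post a (ses f g hf hfg hg).extClass rfl, HE.exact3 a f g i hf hfg hg,
      HE.exact1 a f g i hf hfg hg, fun α β γ h1 h2 e => HE.extnat a f g i hf hfg hg α β γ h1 h2 e⟩
  inj0 {X Y} _ _ _ _ f hf := HE.inj0 a f hf
  p0 X _ _ := HE.p0 a X
  tors i X z := by
    obtain ⟨n, e, rfl⟩ := HE.exists_of a z
    refine ⟨n, fun r hr => ?_⟩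
    change r • HE.of a i X n e = 0
    rw [← map_smul, HE.smul_zero' a e hr, map_zero]
  p4 i X _ _ hX := HE.p4 a i X hX

end HE

end Part8

section Part9
open IsLocalRing CategoryTheory

namespace LCD
section bc
variable {R : Type u} [CommRing R] {a : Ideal R} (D : LCD R a) (S : Type u) [CommRing S]
  [Algebra R S]

/-- restriction of scalars -/
noncomputable abbrev rs : ModuleCat.{u} S ⥤ ModuleCat.{u} R := ModuleCat.restrictScalars (algebraMap R S)

theorem hmap_map (i : ℕ) {X Y Z : ModuleCat.{u} S} (f : X ⟶ Y) (g : Y ⟶ Z)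
    (e : (D.H i).obj ((rs (R := R) S).obj X)) :
    ((D.H i).map ((rs (R := R) S).map g)).hom (((D.H i).map ((rs (R := R) S).map f)).hom e) =
      ((D.H i).map ((rs (R := R) S).map (f ≫ g))).hom e := by
  rw [CategoryTheory.Functor.map_comp, CategoryTheory.Functor.map_comp]; rfl

/-- the action -/
noncomputable def act (i : ℕ) (X : ModuleCat.{u} S) :
    S →+* Module.End R ((D.H i).obj ((rs (R := R) S).obj X)) where
  toFun s := ((D.H i).map ((rs (R := R) S).map (s • 𝟙 X))).hom
  map_one' := by
    rw [one_smul, CategoryTheory.Functor.map_id, CategoryTheory.Functor.map_id]; rfl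
  map_mul' s t := by
    have : (s * t) • 𝟙 X = (t • 𝟙 X) ≫ (s • 𝟙 X) := by
      refine ModuleCat.hom_ext (LinearMap.ext fun x => ?_)
      exact mul_smul s t x
    rw [this, CategoryTheory.Functor.map_comp, CategoryTheory.Functor.map_comp]; rfl
  map_zero' := by
    have : (rs (R := R) S).map ((0 : S) • 𝟙 X) = (0 : R) • 𝟙 _ := by
      rw [zero_smul, zero_smul]; rfl
    rw [this, D.map_smul, zero_smul]; rfl
  map_add' s t := by
    have : (rs (R := R) S).map ((s + t) • 𝟙 X) = (rs (R := R) S).map (s • 𝟙 X) +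
        (rs (R := R) S).map (t • 𝟙 X) := by
      refine ModuleCat.hom_ext (LinearMap.ext fun x => ?_)
      exact add_smul s t x
    rw [this, D.map_add]; rfl

/-- the base changed module -/
def BC (i : ℕ) (X : ModuleCat.{u} S) : Type u := (D.H i).obj ((rs (R := R) S).obj X)

noncomputable instance (i : ℕ) (X : ModuleCat.{u} S) : AddCommGroup (BC D S i X) :=
  inferInstanceAs (AddCommGroup ((D.H i).obj ((rs (R := R) S).obj X)))

noncomputable instance (i : ℕ) (X : ModuleCat.{u} S) : Module S (BC D S i X) :=
  letI : Module (Module.End R ((D.H i).obj ((rs (R := R) S).obj X))) (BC D S i X) :=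
    inferInstanceAs (Module (Module.End R ((D.H i).obj ((rs (R := R) S).obj X)))
      ((D.H i).obj ((rs (R := R) S).obj X)))
  Module.compHom (BC D S i X) (act D S i X)

theorem BC.smul_def (i : ℕ) (X : ModuleCat.{u} S) (s : S) (e : BC D S i X) :
    s • e = ((D.H i).map ((rs (R := R) S).map (s • 𝟙 X))).hom e := rfl

theorem BC.algebraMap_smul (i : ℕ) (X : ModuleCat.{u} S) (r : R) (e : BC D S i X) :
    algebraMap R S r • e = (show (D.H i).obj ((rs (R := R) S).obj X) from 
      r • (show (D.H i).obj ((rs (R := R) S).obj X) from e)) := by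
  rw [BC.smul_def]
  have : (rs (R := R) S).map (algebraMap R S r • 𝟙 X) = r • 𝟙 _ := rfl
  rw [this, D.map_smul, CategoryTheory.Functor.map_id]
  rfl

/-- map -/
noncomputable def BC.map (i : ℕ) {X Y : ModuleCat.{u} S} (f : X ⟶ Y) :
    BC D S i X →ₗ[S] BC D S i Y where
  toFun e := ((D.H i).map ((rs (R := R) S).map f)).hom e
  map_add' x y := _root_.map_add ((D.H i).map ((rs (R := R) S).map f)).hom x y
  map_smul' s x := by
    have : (s • 𝟙 X) ≫ f = f ≫ (s • 𝟙 Y) := by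
      refine ModuleCat.hom_ext (LinearMap.ext fun x => ?_)
      exact f.hom.map_smul s x
    have h1 := hmap_map D S i (s • 𝟙 X) f x
    rw [this] at h1
    exact h1.trans (hmap_map D S i f (s • 𝟙 Y) x).symm

theorem tors_map {R S X : Type u} [CommRing R] [CommRing S] [Algebra R S] (a : Ideal R)
    [AddCommGroup X] [Module S X] (x : X) (n : ℕ)
    (h : ∀ r ∈ a ^ n, algebraMap R S r • x = 0) :
    ∀ s ∈ (a.map (algebraMap R S)) ^ n, s • x = 0 := by
  intro s hs
  rw [← Ideal.map_pow] at hs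
  have : (a ^ n).map (algebraMap R S) ≤ LinearMap.ker (LinearMap.toSpanSingleton S X x) := by
    rw [Ideal.map_le_iff_le_comap]
    exact h
  exact this hs

/-- base change of local cohomology data -/
noncomputable def baseChange : LCD S (a.map (algebraMap R S)) where
  H i :=
    { obj := fun X => ModuleCat.of S (BC D S i X)
      map := fun f => ModuleCat.ofHom (BC.map D S i f)
      map_id := by
        intro X
        refine ModuleCat.hom_ext (LinearMap.ext fun x => ?_)
        change ((D.H i).map ((rs (R := R) S).map (𝟙 X))).hom x = x
        rw [CategoryTheory.Functor.map_id, CategoryTheory.Functor.map_id]; rfl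
      map_comp := by
        intro X Y Z f g
        refine ModuleCat.hom_ext (LinearMap.ext fun x => ?_)
        change ((D.H i).map ((rs (R := R) S).map (f ≫ g))).hom x = _
        rw [CategoryTheory.Functor.map_comp, CategoryTheory.Functor.map_comp]; rfl }
  map_smul i X Y s f := by
    refine ModuleCat.hom_ext (LinearMap.ext fun x => ?_)
    have h1 := hmap_map D S i f (s • 𝟙 Y) x
    have : f ≫ (s • 𝟙 Y) = s • f := rfl
    rw [this] at h1
    exact h1.symm
  map_add i X Y f g := by
    refine ModuleCat.hom_ext (LinearMap.ext fun x => ?_)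
    change ((D.H i).map ((rs (R := R) S).map (f + g))).hom x = 
      ((D.H i).map ((rs (R := R) S).map f)).hom x + ((D.H i).map ((rs (R := R) S).map g)).hom x
    have : (rs (R := R) S).map (f + g) = (rs (R := R) S).map f + (rs (R := R) S).map g := rfl
    rw [this, D.map_add]; rfl
  exact i X Y Z _ _ _ _ _ _ f g hf hfg hg :=
    D.exact i ((rs (R := R) S).map (ModuleCat.ofHom f)).hom
      ((rs (R := R) S).map (ModuleCat.ofHom g)).hom hf hfg hg
  delta i X Y Z _ _ _ _ _ _ f g hf hfg hg := by
    obtain ⟨δ, h1, h2, h3⟩ := D.delta i ((rs (R := R) S).map (ModuleCat.ofHom f)).hom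
      ((rs (R := R) S).map (ModuleCat.ofHom g)).hom hf hfg hg
    refine ⟨{ toFun := δ, map_add' := _root_.map_add δ, map_smul' := ?_ }, h1, h2, ?_⟩
    · intro s e
      exact h3 ((rs (R := R) S).map (s • 𝟙 (ModuleCat.of S X))).hom
        ((rs (R := R) S).map (s • 𝟙 (ModuleCat.of S Y))).hom
        ((rs (R := R) S).map (s • 𝟙 (ModuleCat.of S Z))).hom
        (LinearMap.ext fun x => f.map_smul s x) (LinearMap.ext fun x => g.map_smul s x) e
    · intro α β γ h4 h5 e
      exact h3 ((rs (R := R) S).map (ModuleCat.ofHom α)).hom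
        ((rs (R := R) S).map (ModuleCat.ofHom β)).hom
        ((rs (R := R) S).map (ModuleCat.ofHom γ)).hom
        (LinearMap.ext fun x => LinearMap.congr_fun h4 x)
        (LinearMap.ext fun x => LinearMap.congr_fun h5 x) e
  inj0 {X Y} _ _ _ _ f hf := D.inj0 ((rs (R := R) S).map (ModuleCat.ofHom f)).hom hf
  p0 X _ _ := by
    obtain ⟨j, hj, hj'⟩ := D.p0 ((rs (R := R) S).obj (ModuleCat.of S X))
    refine ⟨{ toFun := j, map_add' := _root_.map_add j, map_smul' := ?_ }, hj, ?_⟩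
    · intro s e
      exact hj' ((rs (R := R) S).map (s • 𝟙 (ModuleCat.of S X))).hom e
    · intro α e
      exact hj' ((rs (R := R) S).map (ModuleCat.ofHom α)).hom e
  tors i X e := by
    obtain ⟨n, hn⟩ := D.tors i ((rs (R := R) S).obj X) e
    refine ⟨n, tors_map a (X := BC D S i X) e n fun r hr => ?_⟩
    rw [BC.algebraMap_smul]
    exact hn r hr
  p4 i X _ _ hX := by
    refine D.p4 i ((rs (R := R) S).obj (ModuleCat.of S X)) ?_
    intro x
    obtain ⟨n, hn⟩ := hX x
    refine ⟨n, fun r hr => hn (algebraMap R S r) ?_⟩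
    rw [← Ideal.map_pow]
    exact Ideal.mem_map_of_mem _ hr
end bc
end LCD

end Part9

section Part10
open IsLocalRing CategoryTheory

section shift
open Abelian
variable {R : Type u} [CommRing R] [IsNoetherianRing R]

theorem ext_shift (Z : Type u) [AddCommGroup Z] [Module R Z] [Module.Finite R Z]
    (X : ModuleCat.{u} R) (i : ℕ) (e : Ext.{u} (ModuleCat.of R Z) X (i+1)) :
    ∃ (K : Type u) (_ : AddCommGroup K) (_ : Module R K) (_ : Module.Finite R K)
      (β : Ext.{u} (ModuleCat.of R Z) (ModuleCat.of R K) 1)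
      (e' : Ext.{u} (ModuleCat.of R K) X i), β.comp e' (add_comm 1 i) = e := by
  obtain ⟨n, f, hf⟩ := Module.Finite.exists_fin' R Z
  have hS := ses (LinearMap.ker f).subtype f (Submodule.subtype_injective _)
    (LinearMap.exact_subtype_ker_map f) hf
  have : Projective (ModuleCat.of R (Fin n → R)) := ModuleCat.projective_of_free (Pi.basisFun R (Fin n))
  obtain ⟨e', he'⟩ := Ext.contravariant_sequence_exact₃ hS X e (Ext.eq_zero_of_projective _)
    (add_comm 1 i)
  exact ⟨LinearMap.ker f, inferInstance, inferInstance, inferInstance, hS.extClass, e', he'⟩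

theorem ext_fg (X : Type u) [AddCommGroup X] [Module R X] (i : ℕ) : 
    ∀ (Z : Type u) [AddCommGroup Z] [Module R Z] [Module.Finite R Z]
    (e : Ext.{u} (ModuleCat.of R Z) (ModuleCat.of R X) i), ∃ (X' : Submodule R X),
      X'.FG ∧ ∃ e' : Ext.{u} (ModuleCat.of R Z) (ModuleCat.of R X') i,
      e'.comp (Ext.mk₀ (ModuleCat.ofHom X'.subtype)) (add_zero i) = e := by
  induction i with
  | zero =>
    intro Z _ _ _ e
    obtain ⟨φ, rfl⟩ := (Ext.mk₀_bijective _ _).2 e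
    refine ⟨LinearMap.range φ.hom, ?_, Ext.mk₀ (ModuleCat.ofHom φ.hom.rangeRestrict), ?_⟩
    · rw [← Submodule.map_top]
      exact (Module.Finite.fg_top (R := R) (M := Z)).map φ.hom
    · rw [Ext.mk₀_comp_mk₀]; rfl
  | succ i ih =>
    intro Z _ _ _ e
    obtain ⟨K, _, _, _, β, e', rfl⟩ := ext_shift Z _ i e
    obtain ⟨X', hX', e'', rfl⟩ := ih K e'
    exact ⟨X', hX', β.comp e'' (add_comm 1 i), Ext.comp_assoc_of_third_deg_zero _ _ _ _⟩

theorem ext_surj {Y Q : Type u} [AddCommGroup Y] [Module R Y] [AddCommGroup Q] [Module R Q]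
    (g : Y →ₗ[R] Q) (hg : ∀ (Z : Type u) [AddCommGroup Z] [Module R Z] [Module.Finite R Z]
      (φ : Z →ₗ[R] Q), ∃ ψ : Z →ₗ[R] Y, g ∘ₗ ψ = φ) (i : ℕ) :
    ∀ (Z : Type u) [AddCommGroup Z] [Module R Z] [Module.Finite R Z]
    (e : Ext.{u} (ModuleCat.of R Z) (ModuleCat.of R Q) i), 
      ∃ e' : Ext.{u} (ModuleCat.of R Z) (ModuleCat.of R Y) i,
      e'.comp (Ext.mk₀ (ModuleCat.ofHom g)) (add_zero i) = e := by
  induction i with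
  | zero =>
    intro Z _ _ _ e
    obtain ⟨φ, rfl⟩ := (Ext.mk₀_bijective _ _).2 e
    obtain ⟨ψ, hψ⟩ := hg Z φ.hom
    refine ⟨Ext.mk₀ (ModuleCat.ofHom ψ), ?_⟩
    rw [Ext.mk₀_comp_mk₀]
    exact congrArg Ext.mk₀ (ModuleCat.hom_ext hψ)
  | succ i ih =>
    intro Z _ _ _ e
    obtain ⟨K, _, _, _, β, e', rfl⟩ := ext_shift Z _ i e
    obtain ⟨e'', rfl⟩ := ih K e'
    exact ⟨β.comp e'' (add_comm 1 i), Ext.comp_assoc_of_third_deg_zero _ _ _ _⟩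

variable (a : Ideal R)

theorem lcR_fg (i : ℕ) (X : Type u) [AddCommGroup X] [Module R X] (z : (lcR a).M i X) :
    ∃ X' : Submodule R X, X'.FG ∧ ∃ z' : (lcR a).M i X', (lcR a).map i X'.subtype z' = z := by
  obtain ⟨n, e, rfl⟩ := HE.exists_of a (i := i) (X := ModuleCat.of R X) z
  obtain ⟨X', hX', e', rfl⟩ := ext_fg X i _ e
  exact ⟨X', hX', HE.of a i _ n e', HE.post_of a _ _ n e'⟩

theorem lcR_surj {Y Q : Type u} [AddCommGroup Y] [Module R Y] [AddCommGroup Q] [Module R Q]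
    (g : Y →ₗ[R] Q) (hg : ∀ (Z : Type u) [AddCommGroup Z] [Module R Z] [Module.Finite R Z]
      (φ : Z →ₗ[R] Q), ∃ ψ : Z →ₗ[R] Y, g ∘ₗ ψ = φ) (i : ℕ) :
    Function.Surjective ((lcR a).map i g) := by
  intro z
  obtain ⟨n, e, rfl⟩ := HE.exists_of a (i := i) (X := ModuleCat.of R Q) z
  obtain ⟨e', rfl⟩ := ext_surj g hg i _ e
  exact ⟨HE.of a i _ n e', HE.post_of a _ _ n e'⟩

end shift

section pure
open TensorProduct
variable {R : Type u} [CommRing R] (S : Type u) [CommRing S] [Algebra R S]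
  [Module.FaithfullyFlat R S]

theorem pure_lift (N : Type u) [AddCommGroup N] [Module R N] {Q : Type u} [AddCommGroup Q]
    [Module R Q] (g : S ⊗[R] N →ₗ[R] Q) (hg : Function.Surjective g)
    (hex : Function.Exact (TensorProduct.mk R S N 1) g) [IsNoetherianRing R]
    (Z : Type u) [AddCommGroup Z] [Module R Z] [Module.Finite R Z]
    (φ : Z →ₗ[R] Q) : ∃ ψ : Z →ₗ[R] S ⊗[R] N, g ∘ₗ ψ = φ := by
  classical
  obtain ⟨n, f, hf⟩ := Module.Finite.exists_fin' R Z
  obtain ⟨m, A, hA⟩ := Module.Finite.exists_fin' R (LinearMap.ker f)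
  choose y hy using fun i => hg (φ (f (Pi.single i 1)))
  let ψ : (Fin n → R) →ₗ[R] S ⊗[R] N := (Pi.basisFun R (Fin n)).constr R y
  have hψ : g ∘ₗ ψ = φ ∘ₗ f := by
    refine (Pi.basisFun R (Fin n)).ext fun i => ?_
    rw [LinearMap.comp_apply, Module.Basis.constr_basis]
    simp [hy]
  let c : Fin m → Fin n → R := fun j => (A (Pi.single j 1) : Fin n → R)
  have hc : ∀ j, ψ (c j) = ∑ i, c j i • y i := by
    intro j
    rw [Module.Basis.constr_apply_fintype]
    simp
  have hu : ∀ j, ∃ u : N, TensorProduct.mk R S N 1 u = ψ (c j) := by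
    intro j
    refine (hex _).1 ?_
    have := LinearMap.congr_fun hψ (c j)
    rw [LinearMap.comp_apply, LinearMap.comp_apply,
      show f (c j) = 0 from (A (Pi.single j 1)).2, map_zero] at this
    exact this
  choose u hu using hu
  let B : (Fin n → N) →ₗ[R] (Fin m → N) :=
    LinearMap.pi fun j => ∑ i, c j i • LinearMap.proj i
  have hB : u ∈ LinearMap.range B := by
    rw [← Submodule.Quotient.mk_eq_zero]
    apply Module.FaithfullyFlat.tensorProduct_mk_injective (A := R) (B := S)
    rw [map_zero]
    have h1 : (TensorProduct.mk R S _ 1) ((LinearMap.range B).mkQ u) = ∑ j, LinearMap.lTensor S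
        ((LinearMap.range B).mkQ ∘ₗ LinearMap.single R (fun _ => N) j) (ψ (c j)) := by
      simp_rw [← hu]
      simp only [TensorProduct.mk_apply, LinearMap.lTensor_tmul, LinearMap.comp_apply]
      rw [← TensorProduct.tmul_sum, ← map_sum]
      congr 2
      exact (LinearMap.sum_single_apply _ u).symm
    change (TensorProduct.mk R S _ 1) ((LinearMap.range B).mkQ u) = 0
    rw [h1]
    simp_rw [hc, map_sum, map_smul]
    rw [Finset.sum_comm]
    refine Finset.sum_eq_zero fun i _ => ?_
    have h2 : ∑ j, c j i • ((LinearMap.range B).mkQ ∘ₗ LinearMap.single R (fun _ => N) j) = 0 := by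
      ext v
      simp only [LinearMap.sum_apply, LinearMap.smul_apply, LinearMap.comp_apply, LinearMap.zero_apply]
      simp_rw [← map_smul]
      rw [← map_sum]
      refine (Submodule.Quotient.mk_eq_zero _).2 ⟨Pi.single i v, ?_⟩
      ext j
      simp [B, Pi.single_apply, Finset.sum_apply]
    have h3 := congrArg (fun k => LinearMap.lTensor S k (y i)) h2
    simp only [LinearMap.lTensor_zero, LinearMap.zero_apply] at h3
    rw [← h3, ← LinearMap.coe_lTensorHom, map_sum, LinearMap.sum_apply]
    simp
  obtain ⟨v, hv⟩ := hB
  let ψ' : (Fin n → R) →ₗ[R] S ⊗[R] N := ψ - (TensorProduct.mk R S N 1) ∘ₗ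
    ((Pi.basisFun R (Fin n)).constr R v)
  have hk : LinearMap.ker f ≤ LinearMap.ker ψ' := by
    have : ψ' ∘ₗ (LinearMap.ker f).subtype ∘ₗ A = 0 := by
      refine (Pi.basisFun R (Fin m)).ext fun j => ?_
      have h4 : (Pi.basisFun R (Fin n)).constr R v (c j) = u j := by
        rw [Module.Basis.constr_apply_fintype, ← hv]
        simp [B]
      have : ψ' (c j) = 0 := by
        simp only [ψ', LinearMap.sub_apply, LinearMap.comp_apply]
        rw [h4, hu, sub_self]
      simpa using this
    intro k hk
    obtain ⟨w, hw⟩ := hA ⟨k, hk⟩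
    have h5 := LinearMap.congr_fun this w
    rw [LinearMap.comp_apply, LinearMap.comp_apply, hw] at h5
    exact h5
  let e := (LinearMap.quotKerEquivOfSurjective f hf)
  refine ⟨(LinearMap.ker f).liftQ ψ' hk ∘ₗ e.symm.toLinearMap, LinearMap.ext fun z => ?_⟩
  obtain ⟨w, rfl⟩ := hf z
  have h6 : e.symm (f w) = (LinearMap.ker f).mkQ w := by
    rw [LinearEquiv.symm_apply_eq]; rfl
  have h7 : g ((TensorProduct.mk R S N 1) ((Pi.basisFun R (Fin n)).constr R v w)) = 0 :=
    hex.apply_apply_eq_zero _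
  have h8 := LinearMap.congr_fun hψ w
  simp only [LinearMap.comp_apply, LinearEquiv.coe_coe, h6] at h8 ⊢
  change g (ψ' w) = _
  simp only [ψ', LinearMap.sub_apply, LinearMap.comp_apply, map_sub] at h7 ⊢
  rw [h7, sub_zero, h8]

theorem lcR_ff [IsNoetherianRing R] (a : Ideal R) (N : Type u) [AddCommGroup N] [Module R N]
    (i : ℕ) (h : Subsingleton ((lcR a).M i (S ⊗[R] N))) : Subsingleton ((lcR a).M i N) := by
  have hinj : Function.Injective (TensorProduct.mk R S N 1) :=
    Module.FaithfullyFlat.tensorProduct_mk_injective N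
  suffices Function.Injective ((lcR a).map i (TensorProduct.mk R S N 1)) from this.subsingleton
  cases i with
  | zero => exact (lcR a).inj0 _ hinj
  | succ i =>
    have hex : Function.Exact (TensorProduct.mk R S N 1)
      (LinearMap.range (TensorProduct.mk R S N 1)).mkQ := LinearMap.exact_map_mkQ_range _
    obtain ⟨δ, h1, h2⟩ := (lcR a).delta' i hinj hex (Submodule.mkQ_surjective _)
    have hs := lcR_surj a (LinearMap.range (TensorProduct.mk R S N 1)).mkQ
      (pure_lift S N _ (Submodule.mkQ_surjective _) hex) i
    refine (injective_iff_map_eq_zero _).2 fun z hz => ?_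
    obtain ⟨w, rfl⟩ := (h2 z).1 hz
    obtain ⟨w, rfl⟩ := hs w
    exact h1.apply_apply_eq_zero w
end pure

end Part10

section Part11
open IsLocalRing CategoryTheory
open scoped Pointwise

namespace LCD
section bc
variable {R : Type u} [CommRing R] {a : Ideal R} (D : LCD R a) (S : Type u) [CommRing S]
  [Algebra R S]

/-- identity as an equivalence -/
noncomputable def idE (X : Type u) [AddCommGroup X] [Module R X] [Module S X] [IsScalarTower R S X] :
    X ≃ₗ[R] ((rs (R := R) S).obj (ModuleCat.of S X)) :=
  { AddEquiv.refl X with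
    map_smul' := fun r x => (algebraMap_smul S r x).symm }

theorem bc_sub (i : ℕ) (X : Type u) [AddCommGroup X] [Module R X] [Module S X]
    [IsScalarTower R S X] (h : Subsingleton ((D.baseChange S).M i X)) :
    Subsingleton (D.M i X) := by
  have h' : Subsingleton (D.M i ((rs (R := R) S).obj (ModuleCat.of S X))) := h
  exact (D.equiv i (idE S X)).toEquiv.subsingleton

theorem bc_kill (i : ℕ) (X : Type u) [AddCommGroup X] [Module R X] [Module S X]
    [IsScalarTower R S X] (x : R) (h : ∀ e : D.M i X, x • e = 0) :
    ∀ e : (D.baseChange S).M i X, algebraMap R S x • e = 0 := by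
  have h' : ∀ e : (D.M i ((rs (R := R) S).obj (ModuleCat.of S X))), x • e = 0 := by
    intro e
    obtain ⟨e, rfl⟩ := (D.equiv i (idE S X)).surjective e
    rw [← _root_.map_smul, h, _root_.map_zero]
  intro e
  exact (BC.algebraMap_smul D S i (ModuleCat.of S X) x e).trans (h' e)

theorem map_sum (i : ℕ) {X Y : Type u} [AddCommGroup X] [Module R X] [AddCommGroup Y] [Module R Y]
    {ι : Type*} (s : Finset ι) (f : ι → X →ₗ[R] Y) (e : D.M i X) :
    D.map i (∑ j ∈ s, f j) e = ∑ j ∈ s, D.map i (f j) e := by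
  classical
  induction s using Finset.induction_on with
  | empty =>
    rw [Finset.sum_empty, Finset.sum_empty]
    have := D.map_smul' i (0 : R) (0 : X →ₗ[R] Y) e
    rwa [zero_smul, zero_smul] at this
  | insert j s hj ih =>
    rw [Finset.sum_insert hj, Finset.sum_insert hj, ← ih]
    have := D.map_add i (ModuleCat.ofHom (f j)) (ModuleCat.ofHom (∑ j ∈ s, f j))
    exact LinearMap.congr_fun (congrArg ModuleCat.Hom.hom this) e
end bc
end LCD

section
open TensorProduct
variable {R : Type u} [CommRing R] [IsNoetherianRing R] [IsLocalRing R] (a : Ideal R)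

theorem lcR_van (ha : a ≤ maximalIdeal R) {d : ℕ} (M : Type u) [AddCommGroup M] [Module R M]
    [Module.Finite R M] (hM : dlt R M (d+1)) (P : Type u) [AddCommGroup P] [Module R P]
    (hP : Module.annihilator R M ≤ Module.annihilator R P) :
    Subsingleton ((lcR a).M (d+1) P) := by
  refine subsingleton_of_forall_eq 0 fun z => ?_
  obtain ⟨P', hP', z', rfl⟩ := lcR_fg a (d+1) P z
  have : Module.Finite R P' := Module.Finite.iff_fg.2 hP'
  have := (lcR a).Gr ha (d+1) P' (dlt_of_ann hM
    (hP.trans (LinearMap.annihilator_le_of_injective P'.subtype P'.subtype_injective))) (d+1) le_rfl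
  rw [Subsingleton.elim z' 0, map_zero]

theorem killq (ha : a ≤ maximalIdeal R) {d : ℕ} (M : Type u) [AddCommGroup M] [Module R M]
    [Module.Finite R M] (hM : dlt R M (d+1)) (I : Type u) (Y : Type u) [AddCommGroup Y] [Module R Y]
    (q : (I →₀ M) →ₗ[R] Y) (hq : Function.Surjective q) (x : R)
    (hx : ∀ e : (lcR a).M d M, x • e = 0) : ∀ e : (lcR a).M d Y, x • e = 0 := by
  classical
  intro e
  obtain ⟨δ, h1, h2⟩ := (lcR a).delta' d (f := (LinearMap.ker q).subtype) (g := q)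
    Subtype.val_injective (LinearMap.exact_subtype_ker_map q) hq
  have hv := lcR_van a ha M hM (LinearMap.ker q) (by
    refine le_trans ?_ (LinearMap.annihilator_le_of_injective _
      (LinearMap.ker q).subtype_injective)
    intro r hr
    rw [Module.mem_annihilator] at hr ⊢
    intro m
    ext i
    simp [hr])
  obtain ⟨e, rfl⟩ := (h1 e).1 (Subsingleton.elim _ _)
  rw [← map_smul]
  suffices h : x • e = 0 by rw [h, map_zero]
  obtain ⟨X', ⟨G, hG⟩, z, rfl⟩ := lcR_fg a d _ e
  let s : Finset I := G.biUnion Finsupp.support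
  have hs : X' ≤ Finsupp.supported M R (s : Set I) := by
    rw [← hG, Submodule.span_le]
    intro g hg
    rw [SetLike.mem_coe, Finsupp.mem_supported]
    intro i hi
    exact Finset.mem_coe.2 (Finset.mem_biUnion.2 ⟨g, hg, hi⟩)
  have hsum : X'.subtype = ∑ j ∈ s, (Finsupp.lsingle j : M →ₗ[R] (I →₀ M)) ∘ₗ
      ((Finsupp.lapply j : (I →₀ M) →ₗ[R] M) ∘ₗ X'.subtype) := by
    ext w i
    have hw := hs w.2
    rw [Finsupp.mem_supported] at hw
    simp only [LinearMap.sum_apply, LinearMap.comp_apply, Finsupp.lsingle_apply,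
      Finsupp.lapply_apply, Submodule.subtype_apply, Finsupp.finset_sum_apply, Finsupp.single_apply]
    rw [Finset.sum_ite_eq' s i (fun j => (w : I →₀ M) j)]
    split_ifs with hi
    · rfl
    · by_contra hne
      exact hi (hw (Finsupp.mem_support_iff.2 hne))
  rw [hsum, LCD.map_sum, Finset.smul_sum]
  refine Finset.sum_eq_zero fun j _ => ?_
  rw [LCD.map_comp, ← map_smul, LCD.map_comp, hx, map_zero]

theorem dlt_bc (S : Type u) [CommRing S] [Algebra R S] [IsNoetherianRing S] [IsLocalRing S]
    (hmax : (maximalIdeal R).map (algebraMap R S) = maximalIdeal S) (k : ℕ) :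
    ∀ (M : Type u) [AddCommGroup M] [Module R M] [Module.Finite R M], dlt R M k →
      dlt S (S ⊗[R] M) k := by
  induction k with
  | zero =>
    intro M _ _ _ h
    have := dlt_zero h
    unfold dlt
    rw [Module.supportDim_eq_bot_of_subsingleton]
    exact WithBot.bot_lt_coe _
  | succ k ih =>
    intro M _ _ _ h
    by_cases hc : ∃ c ∈ maximalIdeal R, ∀ p ∈ (Module.annihilator R M).minimalPrimes, c ∉ p
    · obtain ⟨c, hc, hp⟩ := hc
      have h1 : dlt R (QuotSMulTop c M) k := by
        have := Module.supportDim_quotSMulTop_succ_le_of_notMem_minimalPrimes hp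
        exact wb_aux.1 (lt_of_le_of_lt this h)
      have h2 := ih _ h1
      have e := QuotSMulTop.algebraMapTensorEquivTensorQuotSMulTop c M S
      refine dlt_of_quot (c := algebraMap R S c) ?_ (dlt_of_inj h2 e.toLinearMap e.injective)
      rw [← hmax]
      exact Ideal.mem_map_of_mem _ hc
    · push Not at hc
      have hfin := Ideal.finite_minimalPrimes_of_isNoetherianRing R (Module.annihilator R M)
      have hsub : ((maximalIdeal R : Ideal R) : Set R) ⊆
          ⋃ p ∈ (Module.annihilator R M).minimalPrimes, (p : Set R) := by
        intro c hcm
        obtain ⟨p, hp, hcp⟩ := hc c hcm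
        exact Set.mem_biUnion hp hcp
      obtain ⟨p, hp, hle⟩ := (Ideal.subset_union_prime_finite hfin ⊥ ⊥
        (fun p hp _ _ => hp.1.1)).1 hsub
      refine dlt_mono (k := 1) (dlt_one fun q hq hqle => ?_) (by omega)
      have h1 : Module.annihilator R M ≤ q.comap (algebraMap R S) := by
        intro r hr
        refine hqle ?_
        rw [Module.mem_annihilator] at hr ⊢
        intro w
        rw [algebraMap_smul]
        induction w using TensorProduct.induction_on with
        | zero => simp
        | tmul s m => rw [← TensorProduct.tmul_smul, hr, TensorProduct.tmul_zero]
        | add v w hv hw => rw [smul_add, hv, hw, add_zero]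
      have hq' : (q.comap (algebraMap R S)).IsPrime := inferInstance
      have h2 : p ≤ q.comap (algebraMap R S) :=
        hp.2 ⟨hq', h1⟩ ((le_maximalIdeal hq'.ne_top).trans hle)
      have h3 : maximalIdeal S ≤ q := by
        rw [← hmax, Ideal.map_le_iff_le_comap]
        exact hle.trans h2
      exact le_antisymm (le_maximalIdeal hq.ne_top) h3

theorem main_alg (ha : a ≤ maximalIdeal R) {d : ℕ} (M : Type u) [AddCommGroup M] [Module R M]
    [Module.Finite R M] (hM : dlt R M (d+1)) (x : R) (hx : ∀ e : (lcR a).M d M, x • e = 0) :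
    Subsingleton ((lcR a).M d (LinearMap.range (x • (LinearMap.id : M →ₗ[R] M)))) := by
  let S := AdicCompletion (maximalIdeal R) R
  have hmax : (maximalIdeal R).map (algebraMap R S) = maximalIdeal S :=
    (AdicCompletion.maximalIdeal_eq_map (R := R)).symm
  have hff : Module.FaithfullyFlat R S := Module.FaithfullyFlat.of_flat_of_isLocalHom
  have ha' : a.map (algebraMap R S) ≤ maximalIdeal S := by
    rw [← hmax]; exact Ideal.map_mono ha
  have hk := (lcR a).bc_kill S d (S ⊗[R] M) x (killq a ha M hM S (S ⊗[R] M)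
    (Finsupp.lsum R fun s => TensorProduct.mk R S M s) (by
      intro w
      induction w using TensorProduct.induction_on with
      | zero => exact ⟨0, map_zero _⟩
      | tmul s m => exact ⟨Finsupp.single s m, by simp⟩
      | add v w hv hw =>
        obtain ⟨v, rfl⟩ := hv
        obtain ⟨w, rfl⟩ := hw
        exact ⟨v + w, map_add _ _ _⟩) x hx)
  have hdS := dlt_bc S hmax (d+1) M hM
  let f : M →ₗ[R] M := x • LinearMap.id
  apply lcR_ff S
  apply LCD.bc_sub _ S
  refine LCD.complete_case ((lcR a).baseChange S) ha' hdS
    ((LinearMap.range f).subtype.baseChange S) ?_ ?_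
  · exact Module.Flat.lTensor_preserves_injective_linearMap (M := S) _
      (LinearMap.range f).subtype_injective
  · intro e
    obtain ⟨e, rfl⟩ := ((lcR a).baseChange S).surj_map ha' hdS (f.rangeRestrict.baseChange S)
      (LinearMap.lTensor_surjective S f.surjective_rangeRestrict) e
    rw [← LCD.map_comp, ← LinearMap.baseChange_comp]
    have : (LinearMap.range f).subtype ∘ₗ f.rangeRestrict = f := rfl
    rw [this]
    have : f.baseChange S = algebraMap R S x • (LinearMap.id : S ⊗[R] M →ₗ[S] S ⊗[R] M) := by
      ext m
      simp [f]
    rw [this, LCD.map_smul_id, hk]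
end

end Part11

section Part12
open IsLocalRing CategoryTheory

section Link
open Abelian

theorem next_pred (n : ℕ) : (ComplexShape.down ℕ).next n = n - 1 := by
  cases n with
  | zero => simp
  | succ n => simp

theorem cls_zero_iff {D : Type*} [Category* D] [Abelian D] (K : ChainComplex D ℕ) (n : ℕ)
    {J : D} [Injective J] (k : K.X n ⟶ J) (hk : K.d (n + 1) n ≫ k = 0) :
    K.homologyι n ≫ K.descOpcycles k (n + 1) (by simp) hk = 0 ↔
      ∃ h : K.X (n - 1) ⟶ J, K.d n (n - 1) ≫ h = k := by
  constructor
  · intro h0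
    have hE : (ShortComplex.mk (K.homologyι n) (K.fromOpcycles n (n - 1))
        (K.homologyι_comp_fromOpcycles n (n - 1))).Exact :=
      ShortComplex.exact_of_f_is_kernel _ (K.homologyIsKernel n (n - 1) (next_pred n))
    refine ⟨hE.descToInjective (K.descOpcycles k (n + 1) (by simp) hk) h0, ?_⟩
    have := hE.comp_descToInjective (K.descOpcycles k (n + 1) (by simp) hk) h0
    dsimp at this
    rw [← K.p_fromOpcycles n (n - 1), Category.assoc, this, K.p_descOpcycles]
  · rintro ⟨h, rfl⟩
    exact K.homologyι_descOpcycles_eq_zero_of_boundary _ _ _ h rfl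

theorem cls_surj {D : Type*} [Category* D] [Abelian D] (K : ChainComplex D ℕ) (n : ℕ)
    {J : D} [Injective J] (w : K.homology n ⟶ J) :
    ∃ (k : K.X n ⟶ J) (hk : K.d (n + 1) n ≫ k = 0),
      K.homologyι n ≫ K.descOpcycles k (n + 1) (by simp) hk = w := by
  refine ⟨K.pOpcycles n ≫ Injective.factorThru w (K.homologyι n), by simp, ?_⟩
  have : K.descOpcycles (K.pOpcycles n ≫ Injective.factorThru w (K.homologyι n)) (n + 1) (by simp)
      (by simp) = Injective.factorThru w (K.homologyι n) := by
    rw [← cancel_epi (K.pOpcycles n), K.p_descOpcycles]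
  rw [this, Injective.comp_factorThru]

variable {R : Type u} [CommRing R]

theorem extMk_zero_iff {Z X : ModuleCat.{u} R} (P : ProjectiveResolution Z) (n : ℕ)
    (f : P.complex.X n ⟶ X) (hf : P.complex.d (n + 1) n ≫ f = 0) :
    P.extMk f (n + 1) rfl hf = 0 ↔
      ∃ g : P.complex.X (n - 1) ⟶ X, P.complex.d n (n - 1) ≫ g = f := by
  cases n with
  | succ n => exact P.extMk_eq_zero_iff f _ rfl hf n rfl
  | zero =>
    rw [show (∃ g : P.complex.X (0 - 1) ⟶ X, P.complex.d 0 (0 - 1) ≫ g = f) ↔ f = 0 by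
      rw [P.complex.shape 0 (0 - 1) (by simp)]
      simp [eq_comm]]
    constructor
    · intro h
      simp only [← P.extEquivCohomologyClass.apply_eq_iff_eq,
        ProjectiveResolution.extEquivCohomologyClass_extMk,
        ProjectiveResolution.extEquivCohomologyClass_zero,
        CochainComplex.HomComplex.CohomologyClass.mk_eq_zero_iff] at h
      rw [CochainComplex.HomComplex.Cocycle.toSingleMk_mem_coboundaries_iff _ _ _ _ _ 1
        (by simp)] at h
      obtain ⟨g, hg⟩ := h
      have hz : P.cochainComplex.d (-((0 : ℕ) : ℤ)) 1 = 0 := by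
        apply Limits.IsZero.eq_of_tgt
        exact P.cochainComplex.isZero_of_isStrictlyLE 0 1 (by simp)
      rw [hz, Limits.zero_comp] at hg
      rw [← cancel_epi (P.cochainComplexXIso (-((0 : ℕ) : ℤ)) 0 rfl).hom, ← hg, Limits.comp_zero]
    · rintro rfl
      simp

/-- the op of the ring is an injective cogenerator-like object. -/
abbrev opR (R : Type u) [CommRing R] : (ModuleCat.{u} R)ᵒᵖ := Opposite.op (ModuleCat.of R R)

/-- the functor whose derived functors give `Ext` -/
abbrev yF (X : ModuleCat.{u} R) : ModuleCat.{u} R ⥤ (ModuleCat.{u} R)ᵒᵖ :=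
  ((linearYoneda R (ModuleCat.{u} R)).obj X).rightOp

/-- maps as morphisms to `opR` -/
def eM {A X : ModuleCat.{u} R} (f : A ⟶ X) : (yF X).obj A ⟶ opR R :=
  (ModuleCat.ofHom (LinearMap.toSpanSingleton R (A ⟶ X) f)).op

theorem eM_one {A X : ModuleCat.{u} R} (f : A ⟶ X) :
    (ConcreteCategory.hom (eM f).unop : R →ₗ[R] (A ⟶ X)) (1 : R) = f :=
  one_smul R f

theorem eM_ext {A : (ModuleCat.{u} R)ᵒᵖ} {k k' : A ⟶ opR R}
    (h : (ConcreteCategory.hom k.unop : R →ₗ[R] A.unop) (1 : R) =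
      (ConcreteCategory.hom k'.unop : R →ₗ[R] A.unop) (1 : R)) : k = k' := by
  apply Quiver.Hom.unop_inj
  apply ModuleCat.hom_ext
  exact LinearMap.ext_ring h

theorem eM_comp {A B X : ModuleCat.{u} R} (g : A ⟶ B) (f : B ⟶ X) :
    (yF X).map g ≫ eM f = eM (g ≫ f) := by
  apply eM_ext
  rw [eM_one]
  change g ≫ ((1 : R) • f) = g ≫ f
  rw [one_smul]

theorem eM_inj {A X : ModuleCat.{u} R} (f f' : A ⟶ X) (h : eM f = eM f') : f = f' := by
  rw [← eM_one f, ← eM_one f', h]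

theorem eM_surj {A X : ModuleCat.{u} R} (k : (yF X).obj A ⟶ opR R) : ∃ f : A ⟶ X, eM f = k := by
  refine ⟨(ConcreteCategory.hom k.unop : R →ₗ[R] (A ⟶ X)) (1 : R), ?_⟩
  apply eM_ext
  exact eM_one _

theorem eM_zero {A X : ModuleCat.{u} R} : eM (0 : A ⟶ X) = 0 := by
  apply eM_ext
  exact eM_one _

theorem eM_smul {A X : ModuleCat.{u} R} (x : R) (f : A ⟶ X) :
    eM (x • f) = eM f ≫ (x • (𝟙 (ModuleCat.of R R))).op := by
  apply eM_ext
  rw [eM_one]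
  change x • f = (x • (1 : R)) • f
  simp

instance : Injective (opR R) := by
  have : Projective (ModuleCat.of R R) := (IsProjective.iff_projective R).1 inferInstance
  infer_instance
end Link

end Part12

section Part13
open IsLocalRing CategoryTheory

section Link2
open Abelian
variable {R : Type u} [CommRing R]

/-- the complex computing `Ext`, in the opposite category -/
noncomputable abbrev KC {Z : ModuleCat.{u} R} (P : ProjectiveResolution Z) (X : ModuleCat.{u} R) :
    ChainComplex (ModuleCat.{u} R)ᵒᵖ ℕ :=
  ((yF X).mapHomologicalComplex _).obj P.complex

/-- maps as morphisms to `opR` -/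
def eK {Z X : ModuleCat.{u} R} (P : ProjectiveResolution Z) {n : ℕ}
    (f : P.complex.X n ⟶ X) : (KC P X).X n ⟶ opR R := eM f

theorem KC_d {Z X : ModuleCat.{u} R} (P : ProjectiveResolution Z) (n m : ℕ)
    (f : P.complex.X m ⟶ X) :
    (KC P X).d n m ≫ eK P f = eK P (P.complex.d n m ≫ f) :=
  eM_comp _ _

theorem eK_surj {Z X : ModuleCat.{u} R} (P : ProjectiveResolution Z) {n : ℕ}
    (k : (KC P X).X n ⟶ opR R) : ∃ f : P.complex.X n ⟶ X, eK P f = k := eM_surj k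

theorem eK_inj {Z X : ModuleCat.{u} R} (P : ProjectiveResolution Z) {n : ℕ}
    (f f' : P.complex.X n ⟶ X) (h : eK P f = eK P f') : f = f' := eM_inj f f' h

theorem eK_zero {Z X : ModuleCat.{u} R} (P : ProjectiveResolution Z) {n : ℕ} :
    eK P (0 : P.complex.X n ⟶ X) = 0 := eM_zero

theorem KC_hk {Z X : ModuleCat.{u} R} (P : ProjectiveResolution Z) (n m : ℕ)
    (f : P.complex.X m ⟶ X) (hf : P.complex.d n m ≫ f = 0) :
    (KC P X).d n m ≫ eK P f = 0 := by
  rw [KC_d, hf, eK_zero]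

/-- computing by a resolution -/
noncomputable def iK {Z : ModuleCat.{u} R} (P : ProjectiveResolution Z) (X : ModuleCat.{u} R)
    (n : ℕ) : ((yF X).leftDerived n).obj Z ≅ (KC P X).homology n :=
  P.isoLeftDerivedObj (yF X) n

theorem iK_nat {Z Z' : ModuleCat.{u} R} (P : ProjectiveResolution Z)
    (P' : ProjectiveResolution Z') (X : ModuleCat.{u} R) (n : ℕ) {g : Z' ⟶ Z}
    (φ : ProjectiveResolution.Hom P' P g) :
    ((yF X).leftDerived n).map g ≫ (iK P X n).hom = (iK P' X n).hom ≫
      HomologicalComplex.homologyMap (((yF X).mapHomologicalComplex _).map φ.hom) n :=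
  ProjectiveResolution.isoLeftDerivedObj_hom_naturality g P' P φ.hom
    (by simpa using φ.hom_f_zero_comp_π_f_zero) (yF X) n

/-- class of a cocycle, as a morphism -/
noncomputable def hcM {Z X : ModuleCat.{u} R} (P : ProjectiveResolution Z) {n : ℕ}
    (f : P.complex.X n ⟶ X) (hf : P.complex.d (n + 1) n ≫ f = 0) :
    (KC P X).homology n ⟶ opR R :=
  (KC P X).homologyι n ≫
    (KC P X).descOpcycles (eK P f) (n + 1) (by simp) (KC_hk P _ _ f hf)

theorem hcM_zero_iff {Z X : ModuleCat.{u} R} (P : ProjectiveResolution Z) {n : ℕ}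
    (f : P.complex.X n ⟶ X) (hf : P.complex.d (n + 1) n ≫ f = 0) :
    hcM P f hf = 0 ↔
      ∃ g : P.complex.X (n - 1) ⟶ X, P.complex.d n (n - 1) ≫ g = f := by
  unfold hcM
  rw [cls_zero_iff]
  constructor
  · rintro ⟨h, hh⟩
    obtain ⟨g, rfl⟩ := eK_surj P h
    refine ⟨g, eK_inj P _ _ ?_⟩
    rw [← hh]
    exact (KC_d P _ _ g).symm
  · rintro ⟨g, rfl⟩
    exact ⟨eK P g, KC_d P _ _ g⟩

theorem hcM_surj {Z X : ModuleCat.{u} R} (P : ProjectiveResolution Z) {n : ℕ}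
    (w : (KC P X).homology n ⟶ opR R) :
    ∃ (f : P.complex.X n ⟶ X) (hf : P.complex.d (n + 1) n ≫ f = 0), hcM P f hf = w := by
  obtain ⟨k, hk, rfl⟩ := cls_surj (KC P X) n w
  obtain ⟨f, rfl⟩ := eK_surj P k
  refine ⟨f, eK_inj P _ _ ?_, rfl⟩
  rw [eK_zero]
  exact (KC_d P _ _ f).symm.trans hk

theorem hcM_smul {Z X : ModuleCat.{u} R} (P : ProjectiveResolution Z) {n : ℕ} (x : R)
    (f : P.complex.X n ⟶ X) (hf : P.complex.d (n + 1) n ≫ f = 0)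
    (hf' : P.complex.d (n + 1) n ≫ (x • f) = 0) :
    hcM P (x • f) hf' = hcM P f hf ≫ (x • (𝟙 (ModuleCat.of R R))).op := by
  unfold hcM
  rw [Category.assoc, HomologicalComplex.descOpcycles_comp]
  congr 2
  exact eM_smul x f

theorem hcM_map {Z Z' X : ModuleCat.{u} R} (P : ProjectiveResolution Z)
    (P' : ProjectiveResolution Z') {n : ℕ}
    (φ : P'.complex ⟶ P.complex)
    (f : P.complex.X n ⟶ X) (hf : P.complex.d (n + 1) n ≫ f = 0)
    (hf' : P'.complex.d (n + 1) n ≫ (φ.f n ≫ f) = 0) :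
    HomologicalComplex.homologyMap (((yF X).mapHomologicalComplex _).map φ) n ≫ hcM P f hf =
      hcM P' (φ.f n ≫ f) hf' := by
  unfold hcM
  rw [HomologicalComplex.homologyι_naturality_assoc,
    HomologicalComplex.opcyclesMap_comp_descOpcycles]
  congr 2

/-- the old `Ext` -/
noncomputable abbrev oE (Z X : ModuleCat.{u} R) (n : ℕ) : ModuleCat.{u} R :=
  ((Ext R (ModuleCat.{u} R) n).obj (Opposite.op Z)).obj X

/-- class of a cocycle in old `Ext` -/
noncomputable def oc {Z X : ModuleCat.{u} R} (P : ProjectiveResolution Z) {n : ℕ}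
    (f : P.complex.X n ⟶ X) (hf : P.complex.d (n + 1) n ≫ f = 0) : oE Z X n :=
  (ConcreteCategory.hom ((iK P X n).hom ≫ hcM P f hf).unop :
    R →ₗ[R] oE Z X n) (1 : R)

theorem oc_zero_iff {Z X : ModuleCat.{u} R} (P : ProjectiveResolution Z) {n : ℕ}
    (f : P.complex.X n ⟶ X) (hf : P.complex.d (n + 1) n ≫ f = 0) :
    oc P f hf = 0 ↔
      ∃ g : P.complex.X (n - 1) ⟶ X, P.complex.d n (n - 1) ≫ g = f := by
  rw [← hcM_zero_iff P f hf]
  constructor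
  · intro h
    rw [← cancel_epi (iK P X n).hom, Limits.comp_zero]
    apply eM_ext
    exact h
  · intro h
    unfold oc
    rw [h, Limits.comp_zero]
    rfl

theorem oc_surj {Z X : ModuleCat.{u} R} (P : ProjectiveResolution Z) {n : ℕ} (o : oE Z X n) :
    ∃ (f : P.complex.X n ⟶ X) (hf : P.complex.d (n + 1) n ≫ f = 0), oc P f hf = o := by
  let k : ((yF X).leftDerived n).obj Z ⟶ opR R :=
    (ModuleCat.ofHom (LinearMap.toSpanSingleton R (oE Z X n) o)).op
  obtain ⟨f, hf, h⟩ := hcM_surj P ((iK P X n).inv ≫ k)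
  refine ⟨f, hf, ?_⟩
  unfold oc
  rw [h, Iso.hom_inv_id_assoc]
  exact one_smul R o

theorem oc_smul {Z X : ModuleCat.{u} R} (P : ProjectiveResolution Z) {n : ℕ} (x : R)
    (f : P.complex.X n ⟶ X) (hf : P.complex.d (n + 1) n ≫ f = 0)
    (hf' : P.complex.d (n + 1) n ≫ (x • f) = 0) :
    oc P (x • f) hf' = x • oc P f hf := by
  unfold oc
  rw [hcM_smul P x f hf hf', ← Category.assoc]
  refine Eq.trans ?_ (LinearMap.map_smul
    (ConcreteCategory.hom ((iK P X n).hom ≫ hcM P f hf).unop : R →ₗ[R] oE Z X n) x (1 : R))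
  rfl

theorem oc_map {Z Z' X : ModuleCat.{u} R} (P : ProjectiveResolution Z)
    (P' : ProjectiveResolution Z') {n : ℕ} {g : Z' ⟶ Z}
    (φ : ProjectiveResolution.Hom P' P g)
    (f : P.complex.X n ⟶ X) (hf : P.complex.d (n + 1) n ≫ f = 0)
    (hf' : P'.complex.d (n + 1) n ≫ (φ.hom.f n ≫ f) = 0) :
    ConcreteCategory.hom (((Ext R (ModuleCat.{u} R) n).map g.op).app X) (oc P f hf) =
      oc P' (φ.hom.f n ≫ f) hf' := by
  have h := iK_nat P P' X n φ
  unfold oc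
  rw [← hcM_map P P' φ.hom f hf hf', ← Category.assoc, ← h, Category.assoc]
  rfl

theorem extMk_smul {Z X : ModuleCat.{u} R} (P : ProjectiveResolution Z) {n : ℕ} (x : R)
    (f : P.complex.X n ⟶ X) (hf : P.complex.d (n + 1) n ≫ f = 0)
    (hf' : P.complex.d (n + 1) n ≫ (x • f) = 0) :
    P.extMk (x • f) (n + 1) rfl hf' = x • P.extMk f (n + 1) rfl hf := by
  rw [Ext.smul_eq_comp_mk₀, P.extMk_comp_mk₀]
  simp

end Link2

end Part13

section Part14
open IsLocalRing CategoryTheory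

section Link3
open Abelian Limits
variable {R : Type u} [CommRing R]

theorem HE.of_zero (a : Ideal R) {i : ℕ} {X : ModuleCat.{u} R} {n : ℕ} (e : Abelian.Ext.{u} (Zq a n) X i) :
    HE.of a i X n e = 0 ↔ ∃ m, ∃ h : n ≤ m, trE a i X n m h e = 0 := by
  constructor
  · intro h
    exact Module.DirectLimit.of.zero_exact h
  · rintro ⟨m, h, h0⟩
    rw [← HE.of_tr a h e, ← trE_apply, h0, map_zero]

/-- diagram at X -/
noncomputable abbrev dgX (a : Ideal R) (i : ℕ) (X : ModuleCat.{u} R) :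
    (ℕᵒᵖ)ᵒᵖ ⥤ ModuleCat.{u} R :=
  localCohomology.diagram (localCohomology.idealPowersDiagram a) i ⋙ (evaluation _ _).obj X

theorem LC_colim (a : Ideal R) (i : ℕ) (X : ModuleCat.{u} R) :
    ∃ c : Cocone (dgX a i X), Nonempty (IsColimit c) ∧
      c.pt = (localCohomology a i).obj X := by
  have := localCohomology.hasColimitDiagram.{u, 0} (localCohomology.idealPowersDiagram a) i
  refine ⟨((evaluation _ _).obj X).mapCocone (colimit.cocone (localCohomology.diagram (localCohomology.idealPowersDiagram a) i)), ⟨isColimitOfPreserves ((evaluation _ _).obj X) (colimit.isColimit _)⟩, rfl⟩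

theorem dgX_map (a : Ideal R) (i : ℕ) (X : ModuleCat.{u} R) {n m : ℕ} (h : n ≤ m)
    (w : (Opposite.op (Opposite.op n) : (ℕᵒᵖ)ᵒᵖ) ⟶ Opposite.op (Opposite.op m)) :
    (dgX a i X).map w =
      ((Ext R (ModuleCat.{u} R) i).map (tr a h).op).app X := rfl

theorem LC_props (a : Ideal R) (i : ℕ) (X : ModuleCat.{u} R) :
    ∃ ι : ∀ n, oE (Zq a n) X i →ₗ[R] (localCohomology a i).obj X,
      (∀ z, ∃ n o, ι n o = z) ∧
      ∀ n o, ι n o = 0 ↔ ∃ m, ∃ h : n ≤ m,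
        ConcreteCategory.hom (((Ext R (ModuleCat.{u} R) i).map (tr a h).op).app X) o = 0 := by
  have hp : PreservesFilteredColimitsOfSize.{0, 0} (forget (ModuleCat.{u} R)) :=
    preservesFilteredColimitsOfSize_shrink.{0, u, 0, u} _
  have hp' : PreservesColimitsOfShape (ℕᵒᵖ)ᵒᵖ (forget (ModuleCat.{u} R)) :=
    hp.preserves_filtered_colimits (ℕᵒᵖ)ᵒᵖ
  obtain ⟨c, ⟨hc⟩, hpt⟩ := LC_colim a i X
  rw [← hpt]
  refine ⟨fun n => (c.ι.app (Opposite.op (Opposite.op n))).hom, ?_, ?_⟩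
  · intro z
    obtain ⟨⟨⟨n⟩⟩, o, ho⟩ := Concrete.isColimit_exists_rep _ hc z
    exact ⟨n, o, ho⟩
  · intro n o
    constructor
    · intro h
      obtain ⟨⟨⟨m⟩⟩, f, g, hfg⟩ := Concrete.isColimit_exists_of_rep_eq (dgX a i X) hc
        (i := Opposite.op (Opposite.op n)) (j := Opposite.op (Opposite.op n)) o 0
        (h.trans (map_zero _).symm)
      have hnm : n ≤ m := f.unop.unop.down.down
      refine ⟨m, hnm, ?_⟩
      rw [← dgX_map a i X hnm f]
      exact hfg.trans (map_zero _)
    · rintro ⟨m, h, h0⟩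
      let w : (Opposite.op (Opposite.op n) : (ℕᵒᵖ)ᵒᵖ) ⟶ Opposite.op (Opposite.op m) :=
        (homOfLE h).op.op
      have := c.w w
      have h3 := congrArg (fun (k : (dgX a i X).obj (Opposite.op (Opposite.op n)) ⟶ c.pt) =>
        k.hom o) this
      refine h3.symm.trans ?_
      change (c.ι.app (Opposite.op (Opposite.op m))).hom (ConcreteCategory.hom (((Ext R (ModuleCat.{u} R) i).map (tr a h).op).app X) o) = 0
      rw [h0]
      exact LinearMap.map_zero _

theorem trans_iff (a : Ideal R) (i : ℕ) (X : ModuleCat.{u} R) {n m : ℕ} (h : n ≤ m)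
    (P : ProjectiveResolution (Zq a n)) (f : P.complex.X i ⟶ X)
    (hf : P.complex.d (i + 1) i ≫ f = 0) :
    ConcreteCategory.hom (((Ext R (ModuleCat.{u} R) i).map (tr a h).op).app X) (oc P f hf) = 0 ↔
      trE a i X n m h (P.extMk f (i + 1) rfl hf) = 0 := by
  let P' := projectiveResolution (Zq a m)
  let φ : ProjectiveResolution.Hom P' P (tr a h) :=
    ⟨ProjectiveResolution.lift (tr a h) P' P, by
      simpa using ProjectiveResolution.lift_commutes_zero (tr a h) P' P⟩
  have hf' : P'.complex.d (i + 1) i ≫ (φ.hom.f i ≫ f) = 0 := by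
    simp [← φ.hom.comm_assoc, hf]
  rw [oc_map P P' φ f hf hf', trE_apply, ProjectiveResolution.mk₀_comp_extMk f _ _ hf φ,
    oc_zero_iff, extMk_zero_iff]

theorem link (a : Ideal R) (i : ℕ) (X : ModuleCat.{u} R) (x : R) :
    (∀ z : (localCohomology a i).obj X, x • z = 0) ↔ ∀ z : HE a i X, x • z = 0 := by
  obtain ⟨ι, h1, h2⟩ := LC_props a i X
  have key : ∀ n (P : ProjectiveResolution (Zq a n)) (f : P.complex.X i ⟶ X)
    (hf : P.complex.d (i + 1) i ≫ f = 0),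
    x • ι n (oc P f hf) = 0 ↔ x • HE.of a i X n (P.extMk f (i + 1) rfl hf) = 0 := by
    intro n P f hf
    have hf' : P.complex.d (i + 1) i ≫ (x • f) = 0 := by
      rw [Linear.comp_smul, hf, smul_zero]
    rw [← map_smul, ← map_smul, ← oc_smul P x f hf hf', ← extMk_smul P x f hf hf', h2, HE.of_zero]
    exact exists_congr fun m => exists_congr fun h => trans_iff a i X h P _ hf'
  constructor
  · intro H z
    obtain ⟨n, e, rfl⟩ := HE.exists_of a z
    obtain ⟨f, hf, rfl⟩ := (projectiveResolution (Zq a n)).extMk_surjective e _ rfl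
    exact (key _ _ _ _).1 (H _)
  · intro H z
    obtain ⟨n, o, rfl⟩ := h1 z
    obtain ⟨f, hf, rfl⟩ := oc_surj (projectiveResolution (Zq a n)) o
    exact (key _ _ _ _).2 (H _)
end Link3

end Part14

section Part15
open IsLocalRing CategoryTheory
section Final
variable {R : Type u} [CommRing R] [IsNoetherianRing R]

theorem lc_ann (a : Ideal R) (i : ℕ) (M : Type u) [AddCommGroup M] [Module R M] (x : R) :
    (∀ z : (localCohomology a i).obj (ModuleCat.of R M), x • z = 0) ↔
      ∀ z : (lcR a).M i M, x • z = 0 := link a i (ModuleCat.of R M) x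

theorem sub_iff_one {N : Type*} [AddCommGroup N] [Module R N] :
    Subsingleton N ↔ ∀ z : N, (1 : R) • z = 0 := by
  constructor
  · intro h z
    exact Subsingleton.elim _ _
  · intro h
    exact ⟨fun y z => by rw [← one_smul R y, ← one_smul R z, h, h]⟩

theorem lc_nonzero (a : Ideal R) (i : ℕ) (M : Type u) [AddCommGroup M] [Module R M] :
    LCNonzero a i M ↔ ¬ Subsingleton ((lcR a).M i M) := by
  rw [sub_iff_one (R := R), ← lc_ann, ← sub_iff_one, not_subsingleton_iff_nontrivial]

theorem cd_iff [IsLocalRing R] (a : Ideal R) (ha : a ≤ maximalIdeal R) (d : ℕ)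
    (L : Type u) [AddCommGroup L] [Module R L] [Module.Finite R L] (hL : dlt R L (d + 1)) :
    cohDim a L < (d : ℕ∞) ↔ Subsingleton ((lcR a).M d L) := by
  constructor
  · intro h
    by_contra hn
    rw [← lc_nonzero] at hn
    refine absurd h (not_lt.2 ?_)
    exact le_sSup ⟨d, rfl, hn⟩
  · intro h
    have key : ∀ i, LCNonzero a i L → i < d := by
      intro i hi
      rw [lc_nonzero] at hi
      by_contra hc
      apply hi
      rcases Nat.lt_or_ge d i with h1 | h1
      · exact (lcR a).Gr ha (d + 1) L hL i h1
      · have : i = d := by omega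
        rw [this]
        exact h
    cases d with
    | zero =>
      have : cohDim a L ≤ ⊥ := by
        refine sSup_le ?_
        rintro _ ⟨i, rfl, hi⟩
        exact absurd (key i hi) (by omega)
      rw [le_bot_iff.1 this]
      exact WithBot.bot_lt_coe _
    | succ d =>
      have : cohDim a L ≤ ((d : ℕ∞) : WithBot ℕ∞) := by
        refine sSup_le ?_
        rintro _ ⟨i, rfl, hi⟩
        have := key i hi
        exact_mod_cast Nat.lt_succ_iff.1 this
      refine this.trans_lt ?_
      exact_mod_cast Nat.lt_succ_self d
end Final

end Part15

/-- Over a local ring, if `dim M = d` and `H^d_𝔞(M) ≠ 0`, then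
`Ann_R(H^d_𝔞(M)) = Ann_R(M ⧸ T_R(𝔞, M))`. -/
theorem stmt_9 {R : Type u} [CommRing R] [IsNoetherianRing R] [IsLocalRing R] (𝔞 : Ideal R)
    (M : Type u) [AddCommGroup M] [Module R M] [Module.Finite R M] [Nontrivial M]
    (d : ℕ) (hd : modDim R M = (d : ℕ∞)) (htop : LCNonzero 𝔞 d M)
    (T : Submodule R M) (hT : cohDim 𝔞 ↥T < (d : ℕ∞))
    (hTmax : ∀ L : Submodule R M, cohDim 𝔞 ↥L < (d : ℕ∞) → L ≤ T) :
    Module.annihilator R ((localCohomology 𝔞 d).obj (ModuleCat.of R M)) =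
      Module.annihilator R (M ⧸ T) := by
  have ha : 𝔞 ≤ IsLocalRing.maximalIdeal R := by
    apply IsLocalRing.le_maximalIdeal
    rintro rfl
    rw [lc_nonzero] at htop
    apply htop
    rw [sub_iff_one (R := R)]
    intro z
    obtain ⟨n, e, rfl⟩ := HE.exists_of (⊤ : Ideal R) (i := d) (X := ModuleCat.of R M) z
    obtain ⟨n, hn⟩ := (lcR (⊤ : Ideal R)).tors d _ (HE.of (⊤ : Ideal R) d (ModuleCat.of R M) n e)
    exact hn 1 (by rw [Ideal.top_pow]; trivial)
  have hdM : dlt R M (d + 1) := by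
    unfold dlt
    rw [Module.supportDim_eq_ringKrullDim_quotient_annihilator]
    unfold modDim at hd
    rw [hd]
    exact_mod_cast Nat.lt_succ_self d
  have hdL : ∀ L : Submodule R M, dlt R L (d + 1) := fun L =>
    dlt_of_inj hdM L.subtype L.subtype_injective
  ext x
  rw [Module.mem_annihilator, Module.mem_annihilator, lc_ann]
  constructor
  · intro hx
    have h1 := main_alg 𝔞 ha M hdM x hx
    have h2 := hTmax _ ((cd_iff 𝔞 ha d _ (hdL _)).2 h1)
    intro m
    obtain ⟨m, rfl⟩ := T.mkQ_surjective m
    rw [← map_smul, T.mkQ_apply, Submodule.Quotient.mk_eq_zero]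
    exact h2 ⟨m, rfl⟩
  · intro hx z
    have hs : Subsingleton ((lcR 𝔞).M d T) := (cd_iff 𝔞 ha d _ (hdL T)).1 hT
    have hE := (lcR 𝔞).exact' d T.subtype_injective (LinearMap.exact_subtype_mkQ T) T.mkQ_surjective
    have hann := (lcR 𝔞).ann_le d (M ⧸ T) (Module.mem_annihilator.2 hx)
    rw [Module.mem_annihilator] at hann
    obtain ⟨y, hy⟩ := (hE (x • z)).1 (by rw [map_smul, hann])
    rw [← hy, Subsingleton.elim y 0, map_zero]
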